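/- arXiv:2405.16647 — 7 statements merged into one kernel-verified Lean document; each statement's English description precedes it below -/
import Mathlib

section
/- Let p be an odd prime, n a positive integer, q = p^n with q ≡ 3 (mod 4), and let F be a finite field with exactly q elements. Let Γ³ = {(ξ,τ,σ) ∈ F²×F×F : τσ = ξ·ξ} \ {0} (the punctured cone). For every function f : Γ³ → ℂ one has ∑_{η ∈ F⁴} | ∑_{(η₁,η₂) ∈ Γ³×Γ³ with η₁+η₂=η} f(η₁)f(η₂) |² ≤ ((q⁵ − 2q⁴ + 2q³ − 3q + 3)/((q−1)(q²+1))) · ( ∑_{η ∈ Γ³} |f(η)|² )², and equality holds whenever f is a constant function. (This is the combinatorial form of the sharp L²→L⁴ extension inequality from the cone Γ³ ⊂ F⁴, with best constant R*_{Γ³}(2→4) = (1 − 2q⁻¹ + 2q⁻² − 3q⁻⁴ + 3q⁻⁵)^{1/4}(1 − q⁻¹)^{−3/4}(1 + q⁻²)^{−3/4}.) -/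
open Finset

section Counting

variable {F : Type*} [Field F]

/-- The quadratic form whose nonzero isotropic vectors make up the cone. -/
def coneForm (v : F × F × F × F) : F := v.1 ^ 2 + v.2.1 ^ 2 - v.2.2.1 * v.2.2.2

/-- The polar bilinear form of `coneForm`. -/
def conePolar (v w : F × F × F × F) : F :=
  2 * v.1 * w.1 + 2 * v.2.1 * w.2.1 - v.2.2.1 * w.2.2.2 - v.2.2.2 * w.2.2.1

/-- Representatives of the isotropic lines; `none` is the line `ξ = 0, τ = 0`. -/
def isotropicRep : Option (F × F) → F × F × F × F
  | none => (0, 0, 0, 1)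
  | some z => (z.1, z.2, 1, z.1 ^ 2 + z.2 ^ 2)

/-- The isotropic line through a nonzero isotropic vector. -/
def isotropicLine [DecidableEq F] (v : F × F × F × F) : Option (F × F) :=
  if v.2.2.1 = 0 then none else some (v.1 / v.2.2.1, v.2.1 / v.2.2.1)

lemma coneForm_sub (v w : F × F × F × F) :
    coneForm (v - w) = coneForm v - conePolar w v + coneForm w := by
  simp only [coneForm, conePolar, Prod.fst_sub, Prod.snd_sub]; ring

lemma coneForm_smul (c : F) (v : F × F × F × F) : coneForm (c • v) = c ^ 2 * coneForm v := by
  simp only [coneForm, Prod.smul_fst, Prod.smul_snd, smul_eq_mul]; ring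

lemma conePolar_smul_left (c : F) (v w : F × F × F × F) :
    conePolar (c • v) w = c * conePolar v w := by
  simp only [conePolar, Prod.smul_fst, Prod.smul_snd, smul_eq_mul]; ring

lemma coneForm_isotropicRep (u : Option (F × F)) : coneForm (isotropicRep u) = 0 := by
  cases u <;> simp [coneForm, isotropicRep]

lemma isotropicLine_smul_isotropicRep [DecidableEq F] {c : F} (hc : c ≠ 0)
    (u : Option (F × F)) : isotropicLine (c • isotropicRep u) = u := by
  cases u <;> simp [isotropicLine, isotropicRep, hc]

lemma sq_add_sq_eq_zero_of_not_isSquare (h : ¬ IsSquare (-1 : F)) {x y : F}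
    (hxy : x ^ 2 + y ^ 2 = 0) : x = 0 ∧ y = 0 := by
  by_cases hy : y = 0
  · subst hy; simpa using hxy
  · refine absurd ⟨x / y, ?_⟩ h
    field_simp
    linear_combination -hxy

lemma eq_smul_isotropicRep [DecidableEq F] (h : ¬ IsSquare (-1 : F)) {v : F × F × F × F}
    (hv : coneForm v = 0) (hv0 : v ≠ 0) :
    ∃ c : F, c ≠ 0 ∧ v = c • isotropicRep (isotropicLine v) := by
  obtain ⟨x, y, τ, σ⟩ := v
  simp only [coneForm] at hv
  by_cases hτ : τ = 0
  · subst hτ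
    obtain ⟨rfl, rfl⟩ := sq_add_sq_eq_zero_of_not_isSquare h (x := x) (y := y) (by simpa using hv)
    refine ⟨σ, ?_, ?_⟩
    · rintro rfl; exact hv0 rfl
    · simp [isotropicRep, isotropicLine]
  · refine ⟨τ, hτ, ?_⟩
    simp only [isotropicRep, isotropicLine, hτ, if_false, Prod.smul_mk, smul_eq_mul,
      Prod.mk.injEq]
    refine ⟨by field_simp, by field_simp, by simp, ?_⟩
    field_simp
    linear_combination -hv

lemma eq_smul_of_conePolar_eq_zero [DecidableEq F] (h : ¬ IsSquare (-1 : F))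
    {v w : F × F × F × F} (hv : coneForm v = 0) (hw : coneForm w = 0) (hw0 : w ≠ 0)
    (hvw : conePolar v w = 0) : ∃ c : F, v = c • w := by
  obtain ⟨x, y, τ, σ⟩ := v
  obtain ⟨a, b, t, s⟩ := w
  simp only [coneForm, conePolar] at hv hw hvw
  by_cases ht : t = 0
  · subst ht
    obtain ⟨rfl, rfl⟩ := sq_add_sq_eq_zero_of_not_isSquare h (x := a) (y := b) (by simpa using hw)
    have hs : s ≠ 0 := by rintro rfl; exact hw0 rfl
    have hτ : τ = 0 := by simpa [hs] using hvw
    subst hτ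
    obtain ⟨rfl, rfl⟩ := sq_add_sq_eq_zero_of_not_isSquare h (x := x) (y := y) (by simpa using hv)
    exact ⟨σ / s, by simp [hs]⟩
  · have key : (x * t - τ * a) ^ 2 + (y * t - τ * b) ^ 2 = 0 := by
      linear_combination t ^ 2 * hv + τ ^ 2 * hw - t * τ * hvw
    obtain ⟨hx, hy⟩ := sq_add_sq_eq_zero_of_not_isSquare h key
    refine ⟨τ / t, ?_⟩
    simp only [Prod.smul_mk, smul_eq_mul, Prod.mk.injEq]
    refine ⟨?_, ?_, by field_simp, ?_⟩
    · field_simp; linear_combination hx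
    · field_simp; linear_combination hy
    · field_simp
      have : t * (t * σ - τ * s) = 0 := by
        linear_combination -t * hvw + 2 * τ * hw + 2 * a * hx + 2 * b * hy
      have := (mul_eq_zero.mp this).resolve_left ht
      linear_combination this

variable [Fintype F] [DecidableEq F]

open Polynomial in
lemma card_circle_eq_card_unit_circle (h : ¬ IsSquare (-1 : F)) {r : F} (hr : r ≠ 0) :
    #{z : F × F | z.1 ^ 2 + z.2 ^ 2 = r} = #{z : F × F | z.1 ^ 2 + z.2 ^ 2 = 1} := by
  obtain ⟨c, d, hcd⟩ : ∃ c d : F, c ^ 2 + d ^ 2 = r := by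
    have hcard : Fintype.card F % 4 = 3 := by
      rwa [FiniteField.isSquare_neg_one_iff, not_not] at h
    obtain ⟨c, d, hcd⟩ := FiniteField.exists_root_sum_quadratic
      (degree_X_pow 2) (degree_X_pow_sub_C (by decide) r) (by lia : Fintype.card F % 2 = 1)
    refine ⟨c, d, ?_⟩
    simp only [eval_pow, eval_X, eval_sub, eval_C] at hcd
    linear_combination hcd
  symm
  refine card_nbij' (fun z => (c * z.1 - d * z.2, d * z.1 + c * z.2))
    (fun z => ((c * z.1 + d * z.2) / r, (c * z.2 - d * z.1) / r)) ?_ ?_ ?_ ?_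
  · intro z hz
    simp only [mem_coe, mem_filter, mem_univ, true_and] at hz ⊢
    linear_combination r * hz + (z.1 ^ 2 + z.2 ^ 2) * hcd
  · intro z hz
    simp only [mem_coe, mem_filter, mem_univ, true_and] at hz ⊢
    field_simp
    linear_combination r * hz + (z.1 ^ 2 + z.2 ^ 2) * hcd
  · rintro ⟨x, y⟩ -
    simp only [Prod.mk.injEq]
    constructor
    · field_simp; linear_combination x * hcd
    · field_simp; linear_combination y * hcd
  · rintro ⟨x, y⟩ -
    simp only [Prod.mk.injEq]
    constructor
    · field_simp; linear_combination x * hcd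
    · field_simp; linear_combination y * hcd

lemma card_circle (h : ¬ IsSquare (-1 : F)) {r : F} (hr : r ≠ 0) :
    #{z : F × F | z.1 ^ 2 + z.2 ^ 2 = r} = Fintype.card F + 1 := by
  have htot := card_eq_sum_card_fiberwise (s := (univ : Finset (F × F)))
    (t := (univ : Finset F)) (f := fun z => z.1 ^ 2 + z.2 ^ 2) (fun _ _ => by simp)
  have hzero : #{z : F × F | z.1 ^ 2 + z.2 ^ 2 = 0} = 1 := by
    rw [card_eq_one]
    refine ⟨(0, 0), ?_⟩
    ext ⟨x, y⟩
    simp only [mem_filter, mem_univ, true_and, mem_singleton, Prod.mk.injEq]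
    refine ⟨sq_add_sq_eq_zero_of_not_isSquare h, ?_⟩
    rintro ⟨rfl, rfl⟩; simp
  rw [← sum_erase_add _ _ (mem_univ (0 : F)), hzero,
    sum_congr rfl (fun s hs => (card_circle_eq_card_unit_circle h (ne_of_mem_erase hs)).trans
      (card_circle_eq_card_unit_circle h hr).symm), sum_const, card_erase_of_mem (mem_univ _),
    card_univ, card_univ, Fintype.card_prod, smul_eq_mul] at htot
  have hq : 1 < Fintype.card F := Fintype.one_lt_card
  obtain ⟨m, hm⟩ := Nat.exists_eq_add_of_lt hq
  rw [hm] at htot ⊢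
  simp only [Nat.add_sub_cancel] at htot
  have hm' : 0 < 1 + m := by lia
  nlinarith

lemma card_isotropic_orthogonal (h : ¬ IsSquare (-1 : F)) {η : F × F × F × F}
    (hη : coneForm η ≠ 0) :
    #{u : Option (F × F) | conePolar (isotropicRep u) η = 0} = Fintype.card F + 1 := by
  have h2 : (2 : F) ≠ 0 := fun h2 => h ⟨1, by linear_combination -h2⟩
  obtain ⟨a, b, t, s⟩ := η
  simp only [coneForm] at hη
  have hsplit : #{u : Option (F × F) | conePolar (isotropicRep u) (a, b, t, s) = 0}
      = (if t = 0 then 1 else 0)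
        + #{z : F × F | 2 * a * z.1 + 2 * b * z.2 - t * (z.1 ^ 2 + z.2 ^ 2) = s} := by
    rw [card_filter, Fintype.sum_option, card_filter]
    congr 1
    · simp [conePolar, isotropicRep]
    · refine sum_congr rfl fun z _ => if_congr ?_ rfl rfl
      rw [← sub_eq_zero (b := s)]
      simp only [conePolar, isotropicRep]
      ring_nf
  rw [hsplit]
  by_cases ht : t = 0
  · subst ht
    rw [if_pos rfl, add_comm]
    congr 1
    by_cases hb : b = 0
    · subst hb
      have ha : a ≠ 0 := by rintro rfl; simp at hη
      rw [← card_univ]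
      refine card_nbij' (fun z => z.2) (fun y => (s / (2 * a), y)) (by simp) ?_ ?_
        (by intro; simp)
      · intro y _
        simp only [mem_coe, mem_filter, mem_univ, true_and]
        field_simp; ring
      · rintro ⟨x, y⟩ hz
        simp only [mem_coe, mem_filter, mem_univ, true_and] at hz
        simp only [Prod.mk.injEq, and_true]
        field_simp; linear_combination -hz
    · rw [← card_univ]
      refine card_nbij' (fun z => z.1) (fun x => (x, (s - 2 * a * x) / (2 * b))) (by simp)
        ?_ ?_ (by intro; simp)
      · intro y _
        simp only [mem_coe, mem_filter, mem_univ, true_and]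
        field_simp; ring
      · rintro ⟨x, y⟩ hz
        simp only [mem_coe, mem_filter, mem_univ, true_and] at hz
        simp only [Prod.mk.injEq, true_and]
        field_simp; linear_combination -hz
  · rw [if_neg ht, zero_add,
      ← card_circle h (r := (a ^ 2 + b ^ 2 - t * s) / t ^ 2) (div_ne_zero hη (pow_ne_zero 2 ht))]
    refine card_nbij' (fun z => (z.1 - a / t, z.2 - b / t)) (fun z => (z.1 + a / t, z.2 + b / t))
      ?_ ?_ (by intro; simp) (by intro; simp)
    · rintro ⟨x, y⟩ hz
      simp only [mem_coe, mem_filter, mem_univ, true_and] at hz ⊢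
      field_simp
      linear_combination -t * hz
    · rintro ⟨x, y⟩ hz
      simp only [mem_coe, mem_filter, mem_univ, true_and] at hz ⊢
      field_simp at hz ⊢
      linear_combination -hz

/-- The punctured cone. -/
def puncturedCone (F : Type*) [Field F] [Fintype F] [DecidableEq F] :
    Finset (F × F × F × F) :=
  univ.filter fun v => v.2.2.1 * v.2.2.2 = v.1 ^ 2 + v.2.1 ^ 2 ∧ v ≠ 0

lemma mem_puncturedCone {v : F × F × F × F} :
    v ∈ puncturedCone F ↔ coneForm v = 0 ∧ v ≠ 0 := by
  simp only [puncturedCone, mem_filter, mem_univ, true_and, coneForm, sub_eq_zero]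
  rw [eq_comm]

lemma card_puncturedCone_sub_of_coneForm_ne_zero (h : ¬ IsSquare (-1 : F))
    {η : F × F × F × F} (hη : coneForm η ≠ 0) :
    #{v ∈ puncturedCone F | η - v ∈ puncturedCone F} + Fintype.card F = Fintype.card F ^ 2 := by
  have hbij : #{v ∈ puncturedCone F | η - v ∈ puncturedCone F}
      = #{u : Option (F × F) | ¬ conePolar (isotropicRep u) η = 0} := by
    refine card_nbij' isotropicLine
      (fun u => (coneForm η / conePolar (isotropicRep u) η) • isotropicRep u) ?_ ?_ ?_ ?_
    · intro v hv
      simp only [mem_coe, mem_filter, mem_univ, true_and, mem_puncturedCone,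
        coneForm_sub] at hv ⊢
      obtain ⟨⟨hv, hv0⟩, hs, -⟩ := hv
      obtain ⟨c, hc, hvc⟩ := eq_smul_isotropicRep h hv hv0
      intro h0
      rw [hv, hvc, conePolar_smul_left, h0] at hs
      exact hη (by simpa using hs)
    · intro u hu
      simp only [mem_coe, mem_filter, mem_univ, true_and, mem_puncturedCone,
        coneForm_sub, conePolar_smul_left, coneForm_smul, coneForm_isotropicRep] at hu ⊢
      refine ⟨⟨by simp, ?_⟩, by field_simp; simp, ?_⟩
      · refine smul_ne_zero (div_ne_zero hη hu) ?_
        rintro h0; simp [h0, conePolar] at hu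
      · intro h0
        rw [sub_eq_zero] at h0
        apply hη
        rw [h0, coneForm_smul, coneForm_isotropicRep, mul_zero]
    · intro v hv
      simp only [mem_coe, mem_filter, mem_puncturedCone, coneForm_sub] at hv
      obtain ⟨⟨hv, hv0⟩, hs, -⟩ := hv
      obtain ⟨c, hc, hvc⟩ := eq_smul_isotropicRep h hv hv0
      have hd : coneForm η = c * conePolar (isotropicRep (isotropicLine v)) η := by
        rw [← conePolar_smul_left, ← hvc]
        linear_combination hs - hv
      have hne : conePolar (isotropicRep (isotropicLine v)) η ≠ 0 := by
        intro h0; rw [h0, mul_zero] at hd; exact hη hd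
      simp only [hd]
      rw [mul_div_cancel_right₀ _ hne, ← hvc]
    · intro u hu
      simp only [mem_coe, mem_filter, mem_univ, true_and] at hu
      exact isotropicLine_smul_isotropicRep (div_ne_zero hη hu) u
  have hsum := card_filter_add_card_filter_not (s := (univ : Finset (Option (F × F))))
    (fun u => conePolar (isotropicRep u) η = 0)
  rw [card_isotropic_orthogonal h hη, ← hbij, card_univ, Fintype.card_option,
    Fintype.card_prod] at hsum
  lia

lemma card_puncturedCone_sub_of_mem (h : ¬ IsSquare (-1 : F))
    {η : F × F × F × F} (hη : η ∈ puncturedCone F) :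
    #{v ∈ puncturedCone F | η - v ∈ puncturedCone F} + 2 = Fintype.card F := by
  rw [mem_puncturedCone] at hη
  obtain ⟨hη, hη0⟩ := hη
  have himg : ({v ∈ puncturedCone F | η - v ∈ puncturedCone F} : Finset _)
      = (({0, 1} : Finset F)ᶜ).image (· • η) := by
    ext v
    simp only [mem_filter, mem_puncturedCone, mem_image, mem_compl, mem_insert, mem_singleton,
      not_or, coneForm_sub]
    constructor
    · rintro ⟨⟨hv, hv0⟩, hs, hs0⟩
      obtain ⟨c, rfl⟩ := eq_smul_of_conePolar_eq_zero h hv hη hη0 (by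
        linear_combination -hs + hη + hv)
      refine ⟨c, ⟨?_, ?_⟩, rfl⟩
      · rintro rfl; simp at hv0
      · rintro rfl; simp at hs0
    · rintro ⟨c, ⟨hc0, hc1⟩, rfl⟩
      have hpol : conePolar η η = 2 * coneForm η := by simp only [conePolar, coneForm]; ring
      rw [conePolar_smul_left, coneForm_smul, hpol, hη]
      refine ⟨⟨by simp, smul_ne_zero hc0 hη0⟩, by simp, ?_⟩
      have : η - c • η = (1 - c) • η := by rw [sub_smul, one_smul]
      rw [this]
      exact smul_ne_zero (sub_ne_zero.mpr (Ne.symm hc1)) hη0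
  rw [himg, card_image_of_injective _ (smul_left_injective F hη0), ← card_pair (zero_ne_one' F),
    card_compl_add_card]

lemma neg_mem_puncturedCone {v : F × F × F × F} (hv : v ∈ puncturedCone F) :
    -v ∈ puncturedCone F := by
  rw [mem_puncturedCone] at *
  refine ⟨?_, neg_ne_zero.mpr hv.2⟩
  rw [← neg_one_smul F v, coneForm_smul, hv.1, mul_zero]

end Counting

section PairSums

variable {V : Type*} [AddCommGroup V] [DecidableEq V]

/-- The pairs of elements of `G` with sum `η`. -/
def sumPairs (G : Finset V) (η : V) : Finset (V × V) :=
  (G ×ˢ G).filter fun y => y.1 + y.2 = η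

lemma mem_sumPairs {G : Finset V} {η : V} {y : V × V} :
    y ∈ sumPairs G η ↔ (y.1 ∈ G ∧ y.2 ∈ G) ∧ y.1 + y.2 = η := by
  simp [sumPairs]

lemma sum_sumPairs_fst {M : Type*} [AddCommMonoid M] (G : Finset V) (η : V) (h : V → M) :
    ∑ y ∈ sumPairs G η, h y.1 = ∑ v ∈ G with η - v ∈ G, h v := by
  refine sum_nbij' (fun y => y.1) (fun v => (v, η - v)) ?_ ?_ ?_ ?_ (fun _ _ => rfl)
  · rintro ⟨v, w⟩ hy
    obtain ⟨⟨hv, hw⟩, rfl⟩ := mem_sumPairs.mp hy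
    simpa [hv] using hw
  · intro v hv
    rw [mem_filter] at hv
    exact mem_sumPairs.mpr ⟨hv, by simp⟩
  · rintro ⟨v, w⟩ hy
    obtain ⟨-, rfl⟩ := mem_sumPairs.mp hy
    simp
  · simp

lemma sum_sumPairs_snd {M : Type*} [AddCommMonoid M] (G : Finset V) (η : V) (h : V → M) :
    ∑ y ∈ sumPairs G η, h y.2 = ∑ y ∈ sumPairs G η, h y.1 := by
  refine sum_nbij' Prod.swap Prod.swap ?_ ?_ ?_ ?_ (fun _ _ => rfl)
  · rintro ⟨v, w⟩ hy
    obtain ⟨⟨hv, hw⟩, hvw⟩ := mem_sumPairs.mp hy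
    exact mem_sumPairs.mpr ⟨⟨hw, hv⟩, (add_comm w v).trans hvw⟩
  · rintro ⟨v, w⟩ hy
    obtain ⟨⟨hv, hw⟩, hvw⟩ := mem_sumPairs.mp hy
    exact mem_sumPairs.mpr ⟨⟨hw, hv⟩, (add_comm w v).trans hvw⟩
  · simp
  · simp

lemma card_sumPairs (G : Finset V) (η : V) : #(sumPairs G η) = #{v ∈ G | η - v ∈ G} := by
  rw [card_eq_sum_ones, card_eq_sum_ones]
  exact sum_sumPairs_fst G η fun _ => 1

lemma sum_sum_sumPairs [Fintype V] {M : Type*} [AddCommMonoid M] (G : Finset V) (h : V × V → M) :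
    ∑ η, ∑ y ∈ sumPairs G η, h y = ∑ y ∈ G ×ˢ G, h y :=
  sum_fiberwise _ _ _

variable (G : Finset V) (f : V → ℂ)

lemma norm_sum_sumPairs_sq_le (η : V) :
    ‖∑ y ∈ sumPairs G η, f y.1 * f y.2‖ ^ 2
      ≤ #(sumPairs G η) * ∑ y ∈ sumPairs G η, ‖f y.1‖ ^ 2 * ‖f y.2‖ ^ 2 := by
  calc ‖∑ y ∈ sumPairs G η, f y.1 * f y.2‖ ^ 2
      ≤ (∑ y ∈ sumPairs G η, ‖f y.1 * f y.2‖) ^ 2 := by gcongr; exact norm_sum_le _ _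
    _ ≤ #(sumPairs G η) * ∑ y ∈ sumPairs G η, ‖f y.1 * f y.2‖ ^ 2 := sq_sum_le_card_mul_sum_sq
    _ = _ := by simp only [norm_mul, mul_pow]

lemma norm_sum_sumPairs_le (η : V) :
    ‖∑ y ∈ sumPairs G η, f y.1 * f y.2‖ ≤ ∑ v ∈ G, ‖f v‖ ^ 2 := by
  calc ‖∑ y ∈ sumPairs G η, f y.1 * f y.2‖
      ≤ ∑ y ∈ sumPairs G η, (‖f y.1‖ ^ 2 / 2 + ‖f y.2‖ ^ 2 / 2) := by
        refine norm_sum_le_of_le _ fun y _ => ?_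
        rw [norm_mul]
        nlinarith [sq_nonneg (‖f y.1‖ - ‖f y.2‖)]
    _ = ∑ v ∈ G with η - v ∈ G, ‖f v‖ ^ 2 := by
        rw [sum_add_distrib, sum_sumPairs_snd G η (fun v => ‖f v‖ ^ 2 / 2), ← sum_add_distrib,
          sum_congr rfl (fun y _ => add_halves (‖f y.1‖ ^ 2)),
          sum_sumPairs_fst G η (fun v => ‖f v‖ ^ 2)]
    _ ≤ ∑ v ∈ G, ‖f v‖ ^ 2 :=
        sum_le_sum_of_subset_of_nonneg (filter_subset _ _) fun _ _ _ => by positivity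

end PairSums

section Cone

variable {F : Type*} [Field F] [Fintype F] [DecidableEq F]

/-- The sum over `F⁴` splits into the origin, the cone and the anisotropic vectors. -/
lemma sum_eq_zero_add_cone_add_anisotropic {M : Type*} [AddCommMonoid M]
    (h : F × F × F × F → M) :
    ∑ η, h η = h 0 + ∑ η ∈ puncturedCone F, h η + ∑ η with coneForm η ≠ 0, h η := by
  have hset : ({η | coneForm η = 0} : Finset (F × F × F × F)) = insert 0 (puncturedCone F) := by
    ext v
    simp only [mem_filter, mem_univ, true_and, mem_insert, mem_puncturedCone]
    by_cases hv : v = 0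
    · simp [hv, coneForm]
    · simp [hv]
  rw [← sum_filter_add_sum_filter_not univ (fun η : F × F × F × F => coneForm η = 0), hset,
    sum_insert (by simp [mem_puncturedCone])]

lemma card_sumPairs_zero : #(sumPairs (puncturedCone F) 0) = #(puncturedCone F) := by
  rw [card_sumPairs, filter_true_of_mem]
  intro v hv
  simpa using neg_mem_puncturedCone hv

lemma cast_card_sumPairs_of_mem (h : ¬ IsSquare (-1 : F)) {η : F × F × F × F}
    (hη : η ∈ puncturedCone F) :
    (#(sumPairs (puncturedCone F) η) : ℝ) = Fintype.card F - 2 := by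
  rw [card_sumPairs, eq_sub_iff_add_eq]
  exact_mod_cast card_puncturedCone_sub_of_mem h hη

lemma cast_card_sumPairs_of_coneForm_ne_zero (h : ¬ IsSquare (-1 : F)) {η : F × F × F × F}
    (hη : coneForm η ≠ 0) :
    (#(sumPairs (puncturedCone F) η) : ℝ) = (Fintype.card F : ℝ) ^ 2 - Fintype.card F := by
  rw [card_sumPairs, eq_sub_iff_add_eq]
  exact_mod_cast card_puncturedCone_sub_of_coneForm_ne_zero h hη

lemma cast_card_anisotropic :
    (#{η : F × F × F × F | coneForm η ≠ 0} : ℝ)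
      = (Fintype.card F : ℝ) ^ 4 - 1 - #(puncturedCone F) := by
  have := sum_eq_zero_add_cone_add_anisotropic (F := F) (fun _ => (1 : ℝ))
  simp only [sum_const, nsmul_eq_mul, mul_one, card_univ, Fintype.card_prod, Nat.cast_mul] at this
  linear_combination -this

lemma cast_card_puncturedCone (h : ¬ IsSquare (-1 : F)) :
    (#(puncturedCone F) : ℝ) = ((Fintype.card F : ℝ) - 1) * ((Fintype.card F : ℝ) ^ 2 + 1) := by
  have htot := sum_sum_sumPairs (puncturedCone F) (fun _ => (1 : ℝ))
  simp only [sum_const, nsmul_eq_mul, mul_one] at htot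
  rw [sum_eq_zero_add_cone_add_anisotropic, card_sumPairs_zero,
    sum_congr rfl (fun η hη => cast_card_sumPairs_of_mem h hη),
    sum_congr rfl (fun η hη => cast_card_sumPairs_of_coneForm_ne_zero h (mem_filter.mp hη).2),
    sum_const, sum_const, nsmul_eq_mul, nsmul_eq_mul, cast_card_anisotropic, card_product,
    Nat.cast_mul] at htot
  have hq : (1 : ℝ) < Fintype.card F := by exact_mod_cast Fintype.one_lt_card (α := F)
  set g := (#(puncturedCone F) : ℝ)
  set q := (Fintype.card F : ℝ)
  have hg : 0 ≤ g := Nat.cast_nonneg _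
  have hfac : (g - (q - 1) * (q ^ 2 + 1)) * (g + q * (q ^ 2 - 1)) = 0 := by
    linear_combination -htot
  have hpos : 0 < q * (q ^ 2 - 1) := mul_pos (by linarith) (by nlinarith)
  exact sub_eq_zero.mp ((mul_eq_zero.mp hfac).resolve_right (by positivity))

lemma coneForm_add_eq_zero_of_isotropicLine_eq (h : ¬ IsSquare (-1 : F)) {v w : F × F × F × F}
    (hv : v ∈ puncturedCone F) (hw : w ∈ puncturedCone F)
    (hvw : isotropicLine v = isotropicLine w) : coneForm (v + w) = 0 := by
  rw [mem_puncturedCone] at hv hw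
  obtain ⟨c, -, hc⟩ := eq_smul_isotropicRep h hv.1 hv.2
  obtain ⟨d, -, hd⟩ := eq_smul_isotropicRep h hw.1 hw.2
  rw [hc, hd, hvw, ← add_smul, coneForm_smul, coneForm_isotropicRep, mul_zero]

/-- Cauchy–Schwarz over the `q² + 1` isotropic lines. -/
lemma sq_sum_le_card_mul_sum_isotropic_pairs (h : ¬ IsSquare (-1 : F))
    (g : F × F × F × F → ℝ) (hg : ∀ v, 0 ≤ g v) :
    (∑ v ∈ puncturedCone F, g v) ^ 2 ≤ ((Fintype.card F : ℝ) ^ 2 + 1) *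
      ∑ y ∈ puncturedCone F ×ˢ puncturedCone F with coneForm (y.1 + y.2) = 0, g y.1 * g y.2 := by
  have hcard : ((Fintype.card F : ℝ) ^ 2 + 1) = #(univ : Finset (Option (F × F))) := by
    rw [card_univ, Fintype.card_option, Fintype.card_prod]; push_cast; ring
  rw [← sum_fiberwise (puncturedCone F) isotropicLine g, hcard]
  refine sq_sum_le_card_mul_sum_sq.trans ?_
  gcongr
  calc ∑ u, (∑ v ∈ puncturedCone F with isotropicLine v = u, g v) ^ 2
      = ∑ y ∈ puncturedCone F ×ˢ puncturedCone F with isotropicLine y.1 = isotropicLine y.2,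
          g y.1 * g y.2 := by
        rw [← sum_fiberwise ({y ∈ puncturedCone F ×ˢ puncturedCone F |
          isotropicLine y.1 = isotropicLine y.2}) (fun y => isotropicLine y.1)]
        refine sum_congr rfl fun u _ => ?_
        rw [sq, sum_mul_sum, ← sum_product' _ _ (fun v w => g v * g w)]
        refine sum_congr ?_ fun _ _ => rfl
        ext y
        simp only [mem_product, mem_filter]
        grind
    _ ≤ _ := by
        refine sum_le_sum_of_subset_of_nonneg ?_ fun y _ _ => mul_nonneg (hg _) (hg _)
        intro y hy
        simp only [mem_filter, mem_product] at hy ⊢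
        exact ⟨hy.1, coneForm_add_eq_zero_of_isotropicLine_eq h hy.1.1 hy.1.2 hy.2⟩

lemma sum_isotropic_pairs_eq (g : (F × F × F × F) × (F × F × F × F) → ℝ) :
    ∑ y ∈ puncturedCone F ×ˢ puncturedCone F with coneForm (y.1 + y.2) = 0, g y
      = ∑ y ∈ sumPairs (puncturedCone F) 0, g y
        + ∑ η ∈ puncturedCone F, ∑ y ∈ sumPairs (puncturedCone F) η, g y := by
  have hind := sum_sum_sumPairs (puncturedCone F)
    (fun y => if coneForm (y.1 + y.2) = 0 then g y else 0)
  have hinner : ∀ η : F × F × F × F,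
      ∑ y ∈ sumPairs (puncturedCone F) η, (if coneForm (y.1 + y.2) = 0 then g y else 0)
        = if coneForm η = 0 then ∑ y ∈ sumPairs (puncturedCone F) η, g y else 0 := by
    intro η
    rw [sum_congr rfl (fun y hy => by rw [(mem_sumPairs.mp hy).2])]
    split_ifs <;> simp
  rw [sum_filter, ← hind, sum_congr rfl (fun η _ => hinner η),
    sum_eq_zero_add_cone_add_anisotropic, if_pos (by simp [coneForm]),
    sum_congr rfl (fun η hη => if_pos (mem_puncturedCone.mp hη).1),
    sum_congr rfl (fun η hη => if_neg (mem_filter.mp hη).2), sum_const_zero, add_zero]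

theorem sum_norm_sumPairs_sq_le (h : ¬ IsSquare (-1 : F)) (f : F × F × F × F → ℂ) {q : ℝ}
    (hq : q = Fintype.card F) (hq2 : 2 ≤ q) :
    ∑ η, ‖∑ y ∈ sumPairs (puncturedCone F) η, f y.1 * f y.2‖ ^ 2
      ≤ ((q ^ 5 - 2 * q ^ 4 + 2 * q ^ 3 - 3 * q + 3) / ((q - 1) * (q ^ 2 + 1))) *
        (∑ η ∈ puncturedCone F, ‖f η‖ ^ 2) ^ 2 := by
  have hG := cast_card_puncturedCone h
  have hT := sum_sum_sumPairs (puncturedCone F) (fun y => ‖f y.1‖ ^ 2 * ‖f y.2‖ ^ 2)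
  rw [sum_product' _ _ (fun v w => ‖f v‖ ^ 2 * ‖f w‖ ^ 2), ← sum_mul_sum, ← sq,
    sum_eq_zero_add_cone_add_anisotropic] at hT
  have hA := sq_sum_le_card_mul_sum_isotropic_pairs h (fun v => ‖f v‖ ^ 2)
    (fun _ => by positivity)
  rw [sum_isotropic_pairs_eq] at hA
  have hZ1 := norm_sum_sumPairs_sq_le (puncturedCone F) f 0
  have hZ2 := pow_le_pow_left₀ (norm_nonneg _) (norm_sum_sumPairs_le (puncturedCone F) f 0) 2
  rw [card_sumPairs_zero, hG] at hZ1
  have hE := sum_le_sum fun η (hη : η ∈ puncturedCone F) =>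
    (norm_sum_sumPairs_sq_le (puncturedCone F) f η).trans_eq
      (by rw [cast_card_sumPairs_of_mem h hη])
  have hD := sum_le_sum fun η (hη : η ∈ ({η | coneForm η ≠ 0} : Finset (F × F × F × F))) =>
    (norm_sum_sumPairs_sq_le (puncturedCone F) f η).trans_eq
      (by rw [cast_card_sumPairs_of_coneForm_ne_zero h (mem_filter.mp hη).2])
  rw [← mul_sum] at hE hD
  rw [sum_eq_zero_add_cone_add_anisotropic]
  rw [← hq] at hA hZ1 hE hD
  generalize (∑ η ∈ puncturedCone F, ‖f η‖ ^ 2) ^ 2 = T at *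
  generalize ‖∑ y ∈ sumPairs (puncturedCone F) 0, f y.1 * f y.2‖ ^ 2 = Z at *
  generalize ∑ y ∈ sumPairs (puncturedCone F) 0, ‖f y.1‖ ^ 2 * ‖f y.2‖ ^ 2 = b at *
  generalize ∑ η ∈ puncturedCone F,
    ‖∑ y ∈ sumPairs (puncturedCone F) η, f y.1 * f y.2‖ ^ 2 = e' at *
  generalize ∑ η ∈ puncturedCone F,
    ∑ y ∈ sumPairs (puncturedCone F) η, ‖f y.1‖ ^ 2 * ‖f y.2‖ ^ 2 = e at *
  generalize ∑ η with coneForm η ≠ 0,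
    ‖∑ y ∈ sumPairs (puncturedCone F) η, f y.1 * f y.2‖ ^ 2 = d' at *
  generalize ∑ η with coneForm η ≠ 0,
    ∑ y ∈ sumPairs (puncturedCone F) η, ‖f y.1‖ ^ 2 * ‖f y.2‖ ^ 2 = d at *
  have hm : 0 < (q - 1) * (q ^ 2 + 1) := mul_pos (by linarith) (by positivity)
  rw [div_mul_eq_mul_div, le_div_iff₀ hm]
  have hbound : Z + e' + d'
      ≤ Z - (q - 2) * b + (q ^ 2 - q) * T - (q ^ 2 - 2 * q + 2) * (b + e) := by
    linear_combination hE + hD + (q ^ 2 - q) * hT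
  have hb := mul_le_mul_of_nonneg_left hZ1 (by linarith : 0 ≤ q - 2)
  have hae := mul_le_mul_of_nonneg_left hA
    (mul_nonneg (by linarith) (by nlinarith) : 0 ≤ (q - 1) * (q ^ 2 - 2 * q + 2))
  have hZ := mul_le_mul_of_nonneg_left hZ2
    (by nlinarith [sq_nonneg q] : 0 ≤ (q - 1) * (q ^ 2 + 1) - (q - 2))
  have := mul_le_mul_of_nonneg_left hbound hm.le
  linear_combination this + hb + hae + hZ

theorem sum_norm_sumPairs_sq_of_const (h : ¬ IsSquare (-1 : F)) {f : F × F × F × F → ℂ} {q : ℝ}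
    (hq : q = Fintype.card F) (hq2 : 2 ≤ q) {c : ℂ} (hf : ∀ v ∈ puncturedCone F, f v = c) :
    ∑ η, ‖∑ y ∈ sumPairs (puncturedCone F) η, f y.1 * f y.2‖ ^ 2
      = ((q ^ 5 - 2 * q ^ 4 + 2 * q ^ 3 - 3 * q + 3) / ((q - 1) * (q ^ 2 + 1))) *
        (∑ η ∈ puncturedCone F, ‖f η‖ ^ 2) ^ 2 := by
  have hG := cast_card_puncturedCone h
  have hterm : ∀ η, ‖∑ y ∈ sumPairs (puncturedCone F) η, f y.1 * f y.2‖ ^ 2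
      = (#(sumPairs (puncturedCone F) η) : ℝ) ^ 2 * ‖c‖ ^ 4 := by
    intro η
    rw [sum_congr rfl (fun y hy => by
      rw [hf _ (mem_sumPairs.mp hy).1.1, hf _ (mem_sumPairs.mp hy).1.2])]
    rw [sum_const, nsmul_eq_mul, norm_mul, norm_mul, Complex.norm_natCast]
    ring
  have hcone : ∀ η ∈ puncturedCone F,
      (#(sumPairs (puncturedCone F) η) : ℝ) ^ 2 * ‖c‖ ^ 4 = (q - 2) ^ 2 * ‖c‖ ^ 4 := by
    intro η hη
    rw [cast_card_sumPairs_of_mem h hη, hq]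
  have hanis : ∀ η ∈ ({η | coneForm η ≠ 0} : Finset (F × F × F × F)),
      (#(sumPairs (puncturedCone F) η) : ℝ) ^ 2 * ‖c‖ ^ 4 = (q ^ 2 - q) ^ 2 * ‖c‖ ^ 4 := by
    intro η hη
    rw [cast_card_sumPairs_of_coneForm_ne_zero h (mem_filter.mp hη).2, hq]
  have hnorm : ∀ η ∈ puncturedCone F, ‖f η‖ ^ 2 = ‖c‖ ^ 2 := fun η hη => by rw [hf η hη]
  rw [sum_congr rfl (fun η _ => hterm η), sum_eq_zero_add_cone_add_anisotropic,
    card_sumPairs_zero, sum_congr rfl hcone, sum_congr rfl hanis, sum_congr rfl hnorm]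
  simp only [sum_const, nsmul_eq_mul]
  rw [cast_card_anisotropic, hG, ← hq]
  have h1 : q - 1 ≠ 0 := by linarith
  have h2 : q ^ 2 + 1 ≠ 0 := by positivity
  field_simp
  ring

end Cone

/-- Sharp L²→L⁴ extension inequality from the punctured cone Γ³ ⊂ F⁴ when q ≡ 3 (mod 4),
in combinatorial form, with equality for constant functions. -/
theorem cone_sharp_L2_L4_extension
    (p n q : ℕ) (hp : p.Prime) (hp2 : p ≠ 2) (hn : 0 < n) (hq : q = p ^ n)
    (hq4 : q % 4 = 3)
    (F : Type) [Field F] [Fintype F] [DecidableEq F] (hF : Fintype.card F = q)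
    (f : F × F × F × F → ℂ) :
    let Γ : Finset (F × F × F × F) :=
      univ.filter (fun v => v.2.2.1 * v.2.2.2 = v.1 ^ 2 + v.2.1 ^ 2 ∧ v ≠ 0)
    (∑ η : F × F × F × F,
        ‖∑ y ∈ (Γ ×ˢ Γ).filter (fun y => y.1 + y.2 = η), f y.1 * f y.2‖ ^ 2)
      ≤ (((q : ℝ) ^ 5 - 2 * q ^ 4 + 2 * q ^ 3 - 3 * q + 3) / (((q : ℝ) - 1) * (q ^ 2 + 1))) *
        (∑ η ∈ Γ, ‖f η‖ ^ 2) ^ 2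
    ∧ (∀ c : ℂ, (∀ v ∈ Γ, f v = c) →
      (∑ η : F × F × F × F,
        ‖∑ y ∈ (Γ ×ˢ Γ).filter (fun y => y.1 + y.2 = η), f y.1 * f y.2‖ ^ 2)
      = (((q : ℝ) ^ 5 - 2 * q ^ 4 + 2 * q ^ 3 - 3 * q + 3) / (((q : ℝ) - 1) * (q ^ 2 + 1))) *
        (∑ η ∈ Γ, ‖f η‖ ^ 2) ^ 2) := by
  intro Γ
  have h : ¬ IsSquare (-1 : F) := by
    rw [FiniteField.isSquare_neg_one_iff, hF, not_not]
    exact hq4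
  have hqc : (q : ℝ) = Fintype.card F := by rw [hF]
  have hq2 : (2 : ℝ) ≤ q := by exact_mod_cast (by lia : 2 ≤ q)
  exact ⟨sum_norm_sumPairs_sq_le h f hqc hq2,
    fun c hf => sum_norm_sumPairs_sq_of_const h hqc hq2 hf⟩
end

section
/- Let p be an odd prime and let e : ZMod p → ℂ be a nontrivial additive character. Let C = {(ξ₁,ξ₂,τ,σ) ∈ (ZMod p)⁴ : ξ₁² + ξ₂² = τ² + σ²} (the cone Υ₀³ including the origin) and N = |C|. For ε ∈ ℝ define f_ε : (ZMod p)⁴ → ℝ by f_ε(0) = 1 + ε, f_ε(v) = 1 for v ∈ C with v ≠ 0, and f_ε(v) = 0 for v ∉ C, and define Φ : ℝ → ℝ by Φ(ε) = ( ∑_{x ∈ (ZMod p)⁴} | N⁻¹ ∑_{v ∈ C} f_ε(v)·e(x·v) |⁴ ) / ( N⁻¹ ∑_{v ∈ C} f_ε(v)² )². Then Φ is differentiable at 0 and Φ′(0) = 4p²(p−2)(p²−1)²/(p²+p−1)⁵, which is strictly positive. In particular, the constant function 1 on Υ₀³ is not a critical point, hence not a local maximizer, of the L²→L⁴ extension functional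 on Υ₀³. -/
open Finset

/-- The exponential sum of a hyperbolic plane twisted by a linear form. -/
lemma sum_mul_sum_addChar_quadratic {p : ℕ} [Fact p.Prime] (hp2 : p ≠ 2)
    {e : AddChar (ZMod p) ℂ} (he : e.IsPrimitive) {t : ZMod p} (ht : t ≠ 0) (x y : ZMod p) :
    (∑ a, e (t * a ^ 2 + x * a)) * ∑ b, e (-t * b ^ 2 + y * b) =
      p * e (-(x ^ 2 - y ^ 2) / (4 * t)) := by
  have h2 : (2 : ZMod p) ≠ 0 := Ring.two_ne_zero (by rwa [ZMod.ringChar_zmod_n])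
  have h4 : (4 : ZMod p) ≠ 0 := by convert mul_ne_zero h2 h2 using 1; norm_num
  have hterm (a b : ZMod p) : e (t * (a + b) ^ 2 + x * (a + b)) * e (-t * b ^ 2 + y * b) =
      e (t * a ^ 2 + x * a) * e (b * (2 * t * a + x + y)) := by
    rw [← AddChar.map_add_eq_mul, ← AddChar.map_add_eq_mul]
    congr 1
    ring
  have hroot (a : ZMod p) : 2 * t * a + x + y = 0 ↔ a = -(x + y) / (2 * t) := by
    rw [eq_div_iff (mul_ne_zero h2 ht)]
    constructor <;> intro h <;> linear_combination h
  calc (∑ a, e (t * a ^ 2 + x * a)) * ∑ b, e (-t * b ^ 2 + y * b)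
      = ∑ b, ∑ a, e (t * (a + b) ^ 2 + x * (a + b)) * e (-t * b ^ 2 + y * b) := by
        rw [mul_sum]
        refine sum_congr rfl fun b _ => ?_
        rw [← sum_mul]
        congr 1
        exact (Equiv.sum_comp (Equiv.addRight b) fun a => e (t * a ^ 2 + x * a)).symm
    _ = ∑ a, e (t * a ^ 2 + x * a) * ∑ b, e (b * (2 * t * a + x + y)) := by
        simp_rw [hterm]
        rw [sum_comm]
        simp_rw [mul_sum]
    _ = p * e (-(x ^ 2 - y ^ 2) / (4 * t)) := by
        simp_rw [AddChar.sum_mulShift _ he, hroot]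
        simp only [Nat.cast_ite, Nat.cast_zero, mul_ite, mul_zero, sum_ite_eq',
          mem_univ, if_true, ZMod.card]
        rw [mul_comm]
        congr 2
        field_simp
        ring

/-- The quadratic exponential sum of `v₀² + v₁² - v₂² - v₃²` twisted by a linear form. -/
lemma sum_addChar_split_quadratic {p : ℕ} [Fact p.Prime] (hp2 : p ≠ 2)
    {e : AddChar (ZMod p) ℂ} (he : e.IsPrimitive) {t : ZMod p} (ht : t ≠ 0)
    (x : Fin 4 → ZMod p) :
    ∑ v : Fin 4 → ZMod p,
        e (t * (v 0 ^ 2 + v 1 ^ 2 - (v 2 ^ 2 + v 3 ^ 2)) + ∑ i, x i * v i) =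
      p ^ 2 * e (-(x 0 ^ 2 + x 1 ^ 2 - (x 2 ^ 2 + x 3 ^ 2)) / (4 * t)) := by
  have hprod (v : Fin 4 → ZMod p) :
      e (t * (v 0 ^ 2 + v 1 ^ 2 - (v 2 ^ 2 + v 3 ^ 2)) + ∑ i, x i * v i) =
        ∏ i, e (![t, t, -t, -t] i * v i ^ 2 + x i * v i) := by
    simp only [Fin.prod_univ_four, Fin.sum_univ_four, ← AddChar.map_add_eq_mul]
    congr 1
    simp
    ring
  simp_rw [hprod]
  rw [← Fintype.prod_sum fun i a => e (![t, t, -t, -t] i * a ^ 2 + x i * a)]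
  have h02 := sum_mul_sum_addChar_quadratic hp2 he ht (x 0) (x 2)
  have h13 := sum_mul_sum_addChar_quadratic hp2 he ht (x 1) (x 3)
  have hmul : e (-(x 0 ^ 2 + x 1 ^ 2 - (x 2 ^ 2 + x 3 ^ 2)) / (4 * t)) =
      e (-(x 0 ^ 2 - x 2 ^ 2) / (4 * t)) * e (-(x 1 ^ 2 - x 3 ^ 2) / (4 * t)) := by
    rw [← AddChar.map_add_eq_mul]
    congr 1
    ring
  rw [hmul, Fin.prod_univ_four]
  simp only [Matrix.cons_val]
  linear_combination (∑ a, e (t * a ^ 2 + x 1 * a)) * (∑ b, e (-t * b ^ 2 + x 3 * b)) * h02 +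
    p * e (-(x 0 ^ 2 - x 2 ^ 2) / (4 * t)) * h13

/-- The Fourier transform of the cone `v₀² + v₁² = v₂² + v₃²`. -/
lemma sum_addChar_cone {p : ℕ} [Fact p.Prime] (hp2 : p ≠ 2)
    {e : AddChar (ZMod p) ℂ} (he : e.IsPrimitive) (x : Fin 4 → ZMod p) :
    ∑ v : Fin 4 → ZMod p with v 0 ^ 2 + v 1 ^ 2 = v 2 ^ 2 + v 3 ^ 2, e (∑ i, x i * v i) =
      (if x = 0 then (p : ℂ) ^ 3 else 0) +
        (if x 0 ^ 2 + x 1 ^ 2 = x 2 ^ 2 + x 3 ^ 2 then (p : ℂ) ^ 2 else 0) - p := by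
  have hp0 : (p : ℂ) ≠ 0 := Nat.cast_ne_zero.mpr (Fact.out : p.Prime).ne_zero
  have h2 : (2 : ZMod p) ≠ 0 := Ring.two_ne_zero (by rwa [ZMod.ringChar_zmod_n])
  have h4 : (4 : ZMod p) ≠ 0 := by convert mul_ne_zero h2 h2 using 1; norm_num
  have hlin : ∑ v : Fin 4 → ZMod p, e (∑ i, x i * v i) = if x = 0 then (p : ℂ) ^ 4 else 0 := by
    have hprod (v : Fin 4 → ZMod p) : e (∑ i, x i * v i) = ∏ i, e (v i * x i) := by
      simp only [Fin.sum_univ_four, Fin.prod_univ_four, AddChar.map_add_eq_mul, mul_comm]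
    simp_rw [hprod]
    rw [← Fintype.prod_sum fun i a => e (a * x i)]
    simp_rw [AddChar.sum_mulShift _ he, ZMod.card]
    split_ifs with hx
    · simp [hx]
    · obtain ⟨i, hi⟩ := Function.ne_iff.mp hx
      exact prod_eq_zero (mem_univ i) (by
        rw [if_neg (by simpa using hi), Nat.cast_zero])
  have hinv (Q : ZMod p) : ∑ t, e (-Q / (4 * t)) = if Q = 0 then (p : ℂ) else 0 := by
    have hterm (t : ZMod p) : e (-Q / (4 * t)) = e (Equiv.inv (ZMod p) t * (-Q / 4)) := by
      congr 1
      rw [Equiv.inv_apply, div_mul_eq_div_div, div_eq_mul_inv _ t, mul_comm]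
    simp_rw [hterm]
    rw [Equiv.sum_comp (Equiv.inv (ZMod p)) fun t => e (t * (-Q / 4)),
      AddChar.sum_mulShift _ he]
    simp [h4]
  set Q : (Fin 4 → ZMod p) → ZMod p := fun v => v 0 ^ 2 + v 1 ^ 2 - (v 2 ^ 2 + v 3 ^ 2) with hQ
  have hdetect : (p : ℂ) *
      ∑ v : Fin 4 → ZMod p with v 0 ^ 2 + v 1 ^ 2 = v 2 ^ 2 + v 3 ^ 2, e (∑ i, x i * v i) =
      ∑ t, ∑ v : Fin 4 → ZMod p, e (t * Q v + ∑ i, x i * v i) := by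
    rw [sum_comm, sum_filter, mul_sum]
    refine sum_congr rfl fun v _ => ?_
    simp_rw [AddChar.map_add_eq_mul, ← sum_mul]
    rw [AddChar.sum_mulShift _ he, ZMod.card]
    simp only [hQ, sub_eq_zero]
    split_ifs <;> simp
  have hsplit : ∑ t, ∑ v : Fin 4 → ZMod p, e (t * Q v + ∑ i, x i * v i) =
      (if x = 0 then (p : ℂ) ^ 4 else 0) + p ^ 2 * ((if Q x = 0 then (p : ℂ) else 0) - 1) := by
    have hinv' := hinv (Q x)
    rw [Fintype.sum_eq_add_sum_compl 0] at hinv' ⊢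
    have hsum : ∑ t ∈ ({0}ᶜ : Finset (ZMod p)), ∑ v, e (t * Q v + ∑ i, x i * v i) =
        p ^ 2 * ∑ t ∈ ({0}ᶜ : Finset (ZMod p)), e (-Q x / (4 * t)) := by
      rw [mul_sum]
      refine sum_congr rfl fun t ht => ?_
      exact sum_addChar_split_quadratic hp2 he (by simpa using ht) x
    rw [hsum, ← hinv']
    simp [hlin]
  rw [hsplit] at hdetect
  apply mul_left_cancel₀ hp0
  rw [hdetect]
  simp only [hQ, sub_eq_zero]
  split_ifs <;> ring

/-- Constants fail to be critical points for the L²→L⁴ extension inequality on the full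
cone Υ₀³ ⊂ 𝔽_p⁴: the perturbation functional has strictly positive derivative at 0. -/
theorem full_cone_Upsilon_constants_not_critical
    (p : ℕ) [hp : Fact p.Prime] (hp2 : p ≠ 2)
    (e : AddChar (ZMod p) ℂ) (he : ∃ x, e x ≠ 1) :
    let C : Finset (Fin 4 → ZMod p) :=
      univ.filter (fun v => v 0 ^ 2 + v 1 ^ 2 = v 2 ^ 2 + v 3 ^ 2)
    let N : ℕ := C.card
    let fε : ℝ → (Fin 4 → ZMod p) → ℝ :=
      fun ε v => if v ∈ C then (if v = 0 then 1 + ε else 1) else 0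
    let Φ : ℝ → ℝ := fun ε =>
      (∑ x : Fin 4 → ZMod p,
        ‖(N : ℂ)⁻¹ * ∑ v ∈ C, (fε ε v : ℂ) * e (∑ i, x i * v i)‖ ^ 4) /
      ((N : ℝ)⁻¹ * ∑ v ∈ C, fε ε v ^ 2) ^ 2
    HasDerivAt Φ
      (4 * (p : ℝ) ^ 2 * ((p : ℝ) - 2) * ((p : ℝ) ^ 2 - 1) ^ 2 /
        ((p : ℝ) ^ 2 + (p : ℝ) - 1) ^ 5) 0
    ∧ 0 < 4 * (p : ℝ) ^ 2 * ((p : ℝ) - 2) * ((p : ℝ) ^ 2 - 1) ^ 2 /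
        ((p : ℝ) ^ 2 + (p : ℝ) - 1) ^ 5 := by
  intro C N fε Φ
  have hprim : e.IsPrimitive := AddChar.IsPrimitive.of_ne_one fun h => by
    obtain ⟨x, hx⟩ := he
    exact hx (by simp [h])
  have hp3 : (3 : ℝ) ≤ p := by
    have := (Fact.out : p.Prime).two_le
    exact_mod_cast (by omega : 3 ≤ p)
  have h0C : (0 : Fin 4 → ZMod p) ∈ C := by simp [C]
  have hN : (N : ℝ) = p ^ 3 + p ^ 2 - p := by
    have h := sum_addChar_cone hp2 hprim (0 : Fin 4 → ZMod p)
    simp only [Pi.zero_apply, zero_mul, sum_const_zero, AddChar.map_zero_eq_one,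
      sum_const, nsmul_eq_mul, mul_one, if_true] at h
    exact_mod_cast h
  have hNpos : (0 : ℝ) < N := by rw [hN]; nlinarith
  -- Functions constant on each piece are summed over the origin, the punctured cone and the complement of the cone.
  have hsum (F : (Fin 4 → ZMod p) → ℝ) (a b c : ℝ) (ha : F 0 = a)
      (hb : ∀ x ∈ C, x ≠ 0 → F x = b) (hc : ∀ x ∉ C, F x = c) :
      ∑ x ∈ C, F x = a + (N - 1) * b ∧
        ∑ x, F x = a + (N - 1) * b + (p ^ 4 - N) * c := by
    have hC : ∑ x ∈ C, F x = a + (N - 1) * b := by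
      rw [← add_sum_erase C F h0C, ha, sum_congr rfl fun x hx =>
        hb x (mem_of_mem_erase hx) (ne_of_mem_erase hx),
        sum_const, nsmul_eq_mul, cast_card_erase_of_mem h0C]
    refine ⟨hC, ?_⟩
    rw [← sum_add_sum_compl C F, hC, sum_congr rfl fun x hx =>
      hc x (mem_compl.mp hx), sum_const, nsmul_eq_mul, card_compl,
      Nat.cast_sub (card_le_univ C)]
    simp [N]
  let g : (Fin 4 → ZMod p) → ℝ := fun x =>
    (if x = 0 then (p : ℝ) ^ 3 else 0) + (if x ∈ C then (p : ℝ) ^ 2 else 0) - p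
  have hext (ε : ℝ) (x : Fin 4 → ZMod p) :
      ∑ v ∈ C, (fε ε v : ℂ) * e (∑ i, x i * v i) = ((g x + ε : ℝ) : ℂ) := by
    have hterm : ∀ v ∈ C, (fε ε v : ℂ) * e (∑ i, x i * v i) =
        e (∑ i, x i * v i) + if v = 0 then (ε : ℂ) else 0 := by
      intro v hv
      by_cases h : v = 0
      · simp [fε, h, h0C]
      · simp [fε, h, hv]
    rw [sum_congr rfl hterm, sum_add_distrib, sum_addChar_cone hp2 hprim x,
      sum_ite_eq' C, if_pos h0C]
    simp only [g, C, mem_filter, mem_univ, true_and]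
    split_ifs <;> push_cast <;> ring
  have hΦ : Φ = fun ε : ℝ =>
      ((N : ℝ)⁻¹ ^ 4 * ((N + ε) ^ 4 + (N - 1) * (p ^ 2 - p + ε) ^ 4 +
        (p ^ 4 - N) * (-p + ε) ^ 4)) / ((N : ℝ)⁻¹ * ((1 + ε) ^ 2 + (N - 1) * 1)) ^ 2 := by
    funext ε
    have hnum := (hsum (fun x => (g x + ε) ^ 4) ((N + ε) ^ 4) ((p ^ 2 - p + ε) ^ 4)
      ((-p + ε) ^ 4) (by simp [g, h0C, hN]) (fun x hx h0 => by simp [g, hx, h0])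
      (fun x hx => by simp [g, hx, ne_of_mem_of_not_mem h0C hx |>.symm])).2
    have hden := (hsum (fun x => fε ε x ^ 2) ((1 + ε) ^ 2) 1 0 (by simp [fε, h0C])
      (fun x hx h0 => by simp [fε, hx, h0]) (fun x hx => by simp [fε, hx])).1
    simp only [Φ]
    rw [hden, ← hnum, mul_sum]
    congr 1
    refine sum_congr rfl fun x _ => ?_
    rw [hext, norm_mul, mul_pow, Complex.norm_real, Real.norm_eq_abs, Even.pow_abs (by decide)]
    simp
  have hpow (c : ℝ) : HasDerivAt (fun ε : ℝ => (c + ε) ^ 4) (4 * c ^ 3) 0 := by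
    simpa using ((hasDerivAt_id (0 : ℝ)).const_add c).fun_pow 4
  have hsq : HasDerivAt (fun ε : ℝ => (1 + ε) ^ 2) 2 0 := by
    simpa using ((hasDerivAt_id (0 : ℝ)).const_add 1).fun_pow 2
  constructor
  · rw [hΦ]
    have hnum := ((((hpow N).fun_add ((hpow (p ^ 2 - p)).const_mul ((N : ℝ) - 1))).fun_add
      ((hpow (-p)).const_mul ((p : ℝ) ^ 4 - N))).const_mul ((N : ℝ)⁻¹ ^ 4))
    have hden := ((hsq.add_const (((N : ℝ) - 1) * 1)).const_mul ((N : ℝ)⁻¹)).fun_pow 2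
    have hunit : (N : ℝ)⁻¹ * ((1 + 0) ^ 2 + (N - 1) * 1) = 1 := by field_simp; ring
    refine (hnum.fun_div hden (by rw [hunit]; norm_num)).congr_deriv ?_
    have hp0 : (p : ℝ) ≠ 0 := by linarith
    have hq : (p : ℝ) ^ 2 + p - 1 ≠ 0 := by nlinarith
    have hN' : (N : ℝ) = p * (p ^ 2 + p - 1) := by rw [hN]; ring
    simp only [hunit]
    simp only [add_zero, one_pow, mul_one, div_one]
    rw [hN']
    field_simp
    ring
  · have h1 : (0 : ℝ) < p - 2 := by linarith
    have h2 : (0 : ℝ) < p ^ 2 - 1 := by nlinarith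
    have h3 : (0 : ℝ) < p ^ 2 + p - 1 := by nlinarith
    positivity
end

section
/- Let p be a prime with p ≡ 3 (mod 4) and let e : ZMod p → ℂ be a nontrivial additive character. Let C = {(ξ₁,ξ₂,τ,σ) ∈ (ZMod p)⁴ : τσ = ξ₁² + ξ₂²} (the cone Γ₀³ including the origin) and N = |C|. For ε ∈ ℝ define f_ε : (ZMod p)⁴ → ℝ by f_ε(0) = 1 + ε, f_ε(v) = 1 for v ∈ C with v ≠ 0, and f_ε(v) = 0 for v ∉ C, and define Ψ : ℝ → ℝ by Ψ(ε) = ( ∑_{x ∈ (ZMod p)⁴} | N⁻¹ ∑_{v ∈ C} f_ε(v)·e(x·v) |⁴ ) / ( N⁻¹ ∑_{v ∈ C} f_ε(v)² )². Then Ψ is differentiable at 0 and Ψ′(0) = −4p²(p−2)(p−1)²(p²+1)/(p²−p+1)⁵, which is strictly negative. In particular, the constant function 1 on Γ₀³ is not a critical point, hence not a local maximizer, of the L²→L⁴ extension functional on Γ₀³. -/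
open Finset

theorem card_filter_sq_add_sq_eq (p : ℕ) [Fact p.Prime] (r : ZMod p) (hr : r ≠ 0) :
    #{q : ZMod p × ZMod p | q.1 ^ 2 + q.2 ^ 2 = r} =
      #{q : ZMod p × ZMod p | q.1 ^ 2 + q.2 ^ 2 = 1} := by
  obtain ⟨c, d, hcd⟩ := ZMod.sq_add_sq p r
  refine Finset.card_nbij' (fun q => ((c * q.1 + d * q.2) / r, (c * q.2 - d * q.1) / r))
    (fun q => (c * q.1 - d * q.2, d * q.1 + c * q.2)) ?_ ?_ ?_ ?_
  · rintro ⟨a, b⟩ h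
    simp only [mem_coe, mem_filter, mem_univ, true_and] at h ⊢
    field_simp
    linear_combination (c ^ 2 + d ^ 2) * h + r * hcd
  · rintro ⟨a, b⟩ h
    simp only [mem_coe, mem_filter, mem_univ, true_and] at h ⊢
    linear_combination (c ^ 2 + d ^ 2) * h + hcd
  · rintro ⟨a, b⟩ -
    ext
    · simp only
      field_simp
      linear_combination a * hcd
    · simp only
      field_simp
      linear_combination b * hcd
  · rintro ⟨a, b⟩ -
    ext
    · simp only
      field_simp
      linear_combination a * hcd
    · simp only
      field_simp
      linear_combination b * hcd

theorem sq_add_sq_eq_zero_iff_of_mod_four {p : ℕ} [Fact p.Prime] (hp4 : p % 4 = 3)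
    (a b : ZMod p) : a ^ 2 + b ^ 2 = 0 ↔ a = 0 ∧ b = 0 := by
  refine ⟨fun h => ?_, fun ⟨ha, hb⟩ => by simp [ha, hb]⟩
  have hb : b = 0 := by
    by_contra hb
    refine ZMod.mod_four_ne_three_of_sq_eq_neg_one (p := p) (y := a / b) ?_ hp4
    field_simp
    linear_combination h
  subst hb
  simpa using h

theorem card_circle_s10 {p : ℕ} [Fact p.Prime] (hp4 : p % 4 = 3) (r : ZMod p) :
    #{q : ZMod p × ZMod p | q.1 ^ 2 + q.2 ^ 2 = r} = if r = 0 then 1 else p + 1 := by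
  have h0 : #{q : ZMod p × ZMod p | q.1 ^ 2 + q.2 ^ 2 = 0} = 1 := by
    rw [card_eq_one]
    refine ⟨(0, 0), ?_⟩
    ext ⟨a, b⟩
    simp [sq_add_sq_eq_zero_iff_of_mod_four hp4]
  split_ifs with hr
  · rw [hr, h0]
  rw [card_filter_sq_add_sq_eq p r hr]
  have hsum := card_eq_sum_card_fiberwise (s := (univ : Finset (ZMod p × ZMod p)))
    (f := fun q => q.1 ^ 2 + q.2 ^ 2) (t := univ) (by simp)
  rw [← add_sum_erase _ _ (mem_univ 0), h0,
    sum_congr rfl fun r hr => card_filter_sq_add_sq_eq p r (ne_of_mem_erase hr)] at hsum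
  simp only [card_univ, Fintype.card_prod, ZMod.card, sum_const, mem_univ, card_erase_of_mem,
    smul_eq_mul] at hsum
  obtain ⟨k, rfl⟩ : ∃ k, p = k + 2 := ⟨p - 2, by have := (Fact.out : p.Prime).two_le; omega⟩
  simp only [Nat.add_succ_sub_one] at hsum
  have : (k + 1) * #{q : ZMod (k + 2) × ZMod (k + 2) | q.1 ^ 2 + q.2 ^ 2 = 1} =
    (k + 1) * (k + 2 + 1) := by linarith
  exact Nat.eq_of_mul_eq_mul_left (by omega) this

theorem AddChar.sum_mul_eq_ite {p : ℕ} [Fact p.Prime] {e : AddChar (ZMod p) ℂ} (he : e ≠ 1)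
    (a : ZMod p) : ∑ t, e (t * a) = if a = 0 then (p : ℂ) else 0 := by
  have := AddChar.sum_mulShift a (AddChar.IsPrimitive.of_ne_one he)
  simpa using this

theorem card_linear_eq {F : Type*} [Field F] [Fintype F] [DecidableEq F] {a b : F}
    (h : ¬(a = 0 ∧ b = 0)) (c : F) :
    #{q : F × F | a * q.1 + b * q.2 + c = 0} = Fintype.card F := by
  rw [← card_univ]
  by_cases hb : b = 0
  · have ha : a ≠ 0 := fun ha => h ⟨ha, hb⟩
    refine card_nbij' Prod.snd (fun t => (-c / a, t)) (by simp) ?_ ?_ fun _ _ => rfl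
    · intro t _
      simp only [coe_filter, mem_univ, true_and, Set.mem_ofPred_eq, hb]
      field_simp
      ring
    · rintro ⟨s, t⟩ hs
      simp only [coe_filter, mem_univ, true_and, Set.mem_ofPred_eq, hb] at hs
      ext
      · simp only
        field_simp
        linear_combination -hs
      · rfl
  · refine card_nbij' Prod.fst (fun t => (t, -(a * t + c) / b)) (by simp) ?_ ?_ fun _ _ => rfl
    · intro t _
      simp only [coe_filter, mem_univ, true_and, Set.mem_ofPred_eq]
      field_simp
      ring
    · rintro ⟨s, t⟩ hs
      simp only [coe_filter, mem_univ, true_and, Set.mem_ofPred_eq] at hs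
      ext
      · rfl
      · simp only
        field_simp
        linear_combination -hs

theorem card_quadric_section {p : ℕ} [Fact p.Prime] (hp4 : p % 4 = 3) (a b c : ZMod p)
    {d : ZMod p} (hd : d ≠ 0) :
    #{q : ZMod p × ZMod p | a * q.1 + b * q.2 + c + d * (q.1 ^ 2 + q.2 ^ 2) = 0} =
      if 4 * (c * d) = a ^ 2 + b ^ 2 then 1 else p + 1 := by
  have h2 : (2 : ZMod p) ≠ 0 := by
    apply Ring.two_ne_zero
    rw [ZMod.ringChar_zmod_n]
    rintro rfl
    omega
  have hr : (a ^ 2 + b ^ 2 - 4 * (c * d)) / (2 * d) ^ 2 = 0 ↔ 4 * (c * d) = a ^ 2 + b ^ 2 := by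
    rw [div_eq_zero_iff, or_iff_left (by simp [h2, hd]), sub_eq_zero, eq_comm]
  rw [← if_congr hr rfl rfl, ← card_circle_s10 hp4]
  refine card_bijective (fun q => (q.1 + a / (2 * d), q.2 + b / (2 * d))) ?_ ?_
  · exact (Equiv.prodCongr (Equiv.addRight (a / (2 * d))) (Equiv.addRight (b / (2 * d)))).bijective
  · rintro ⟨s, t⟩
    simp only [mem_filter, mem_univ, true_and]
    rw [← sub_eq_zero (b := _ / _)]
    have : (s + a / (2 * d)) ^ 2 + (t + b / (2 * d)) ^ 2 -
        (a ^ 2 + b ^ 2 - 4 * (c * d)) / (2 * d) ^ 2 =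
        (a * s + b * t + c + d * (s ^ 2 + t ^ 2)) / d := by
      field_simp
      ring
    rw [this, div_eq_zero_iff, or_iff_left hd]

/-- The coordinates of a vector in dimension four, grouped in pairs. -/
def finFourArrowEquiv (F : Type*) : (Fin 4 → F) ≃ (F × F) × F × F where
  toFun v := ((v 0, v 1), v 2, v 3)
  invFun q := ![q.1.1, q.1.2, q.2.1, q.2.2]
  left_inv v := by ext i; fin_cases i <;> rfl
  right_inv _ := rfl

theorem sum_cone_eq {p : ℕ} [Fact p.Prime] (hp4 : p % 4 = 3) {e : AddChar (ZMod p) ℂ}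
    (he : e ≠ 1) (x : Fin 4 → ZMod p) :
    ∑ v : Fin 4 → ZMod p with v 2 * v 3 = v 0 ^ 2 + v 1 ^ 2, e (∑ i, x i * v i) =
      p * ((if x 3 = 0 then 1 else 0) +
        #{q : ZMod p × ZMod p | x 0 * q.1 + x 1 * q.2 + x 2 + x 3 * (q.1 ^ 2 + q.2 ^ 2) = 0} - p) := by
  have hfiber (t : ZMod p) (ht : t ≠ 0) :
      ∑ q : ZMod p × ZMod p, ∑ s, (if t * s = q.1 ^ 2 + q.2 ^ 2 then
        e (x 0 * q.1 + x 1 * q.2 + x 2 * t + x 3 * s) else 0) =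
      ∑ q : ZMod p × ZMod p,
        e (t * (x 0 * q.1 + x 1 * q.2 + x 2 + x 3 * (q.1 ^ 2 + q.2 ^ 2))) := by
    symm
    refine Fintype.sum_equiv
      (Equiv.prodCongr (Equiv.mulLeft₀ t ht) (Equiv.mulLeft₀ t ht)) _ _ fun q => ?_
    have (s : ZMod p) : t * s = (t * q.1) ^ 2 + (t * q.2) ^ 2 ↔ s = t * (q.1 ^ 2 + q.2 ^ 2) := by
      rw [← mul_right_inj' ht (b := s)]
      ring_nf
    simp only [Equiv.prodCongr_apply, Prod.map, Equiv.mulLeft₀_apply, this, sum_ite_eq', mem_univ,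
      if_true]
    congr 1
    ring
  have hzero : ∑ q : ZMod p × ZMod p, ∑ s, (if 0 * s = q.1 ^ 2 + q.2 ^ 2 then
      e (x 0 * q.1 + x 1 * q.2 + x 2 * 0 + x 3 * s) else 0) = if x 3 = 0 then (p : ℂ) else 0 := by
    rw [← AddChar.sum_mul_eq_ite he, Fintype.sum_eq_single (0, 0)]
    · simp [mul_comm]
    · rintro ⟨a, b⟩ hab
      refine sum_eq_zero fun s _ => if_neg ?_
      rw [zero_mul, eq_comm, sq_add_sq_eq_zero_iff_of_mod_four hp4]
      simpa using hab
  have hsplit (q : ZMod p × ZMod p) :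
      ∑ t ∈ univ.erase 0, e (t * (x 0 * q.1 + x 1 * q.2 + x 2 + x 3 * (q.1 ^ 2 + q.2 ^ 2))) =
      p * (if x 0 * q.1 + x 1 * q.2 + x 2 + x 3 * (q.1 ^ 2 + q.2 ^ 2) = 0 then 1 else 0) - 1 := by
    rw [sum_erase_eq_sub (mem_univ _), AddChar.sum_mul_eq_ite he]
    simp
  rw [sum_filter, Fintype.sum_equiv (finFourArrowEquiv (ZMod p)) _ (fun q =>
    if q.2.1 * q.2.2 = q.1.1 ^ 2 + q.1.2 ^ 2 then
      e (x 0 * q.1.1 + x 1 * q.1.2 + x 2 * q.2.1 + x 3 * q.2.2) else 0)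
    fun v => by rw [Fin.sum_univ_four]; rfl]
  simp_rw [Fintype.sum_prod_type (α₁ := ZMod p × ZMod p),
    Fintype.sum_prod_type (α₁ := ZMod p) (α₂ := ZMod p) (f := fun y : ZMod p × ZMod p => ite _ _ _)]
  rw [sum_comm, ← add_sum_erase _ _ (mem_univ 0), hzero,
    sum_congr rfl fun t ht => hfiber t (ne_of_mem_erase ht), sum_comm]
  simp only [hsplit, sum_sub_distrib, ← mul_sum, sum_boole, sum_const, card_univ,
    Fintype.card_prod, ZMod.card, nsmul_eq_mul]
  split_ifs <;> push_cast <;> ring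

theorem sum_cone_eq_ite {p : ℕ} [Fact p.Prime] (hp4 : p % 4 = 3) {e : AddChar (ZMod p) ℂ}
    (he : e ≠ 1) (x : Fin 4 → ZMod p) :
    ∑ v : Fin 4 → ZMod p with v 2 * v 3 = v 0 ^ 2 + v 1 ^ 2, e (∑ i, x i * v i) =
      ((if x = 0 then (p : ℝ) ^ 3 - p ^ 2 + p else
        if 4 * (x 2 * x 3) = x 0 ^ 2 + x 1 ^ 2 then (p : ℝ) - p ^ 2 else p : ℝ) : ℂ) := by
  rw [sum_cone_eq hp4 he]
  by_cases h3 : x 3 = 0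
  · by_cases h01 : x 0 = 0 ∧ x 1 = 0
    · have hx : x = 0 ↔ x 2 = 0 := by
        refine ⟨fun h => by simp [h], fun h => ?_⟩
        ext i
        fin_cases i <;> simp [h, h3, h01]
      by_cases h2 : x 2 = 0
      · simp [hx, h2, h3, h01, ZMod.card]
        ring
      · simp [hx, h2, h3, h01]
        ring
    · have hx : x ≠ 0 := by
        rintro rfl
        simp at h01
      have h := (sq_add_sq_eq_zero_iff_of_mod_four hp4 (x 0) (x 1)).not.mpr h01
      simp [hx, h3, card_linear_eq h01, ZMod.card, Ne.symm h]
  · have hx : x ≠ 0 := by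
      rintro rfl
      simp at h3
    rw [card_quadric_section hp4 _ _ _ h3, if_neg hx, if_neg h3]
    split_ifs <;> push_cast <;> ring

theorem card_cone {p : ℕ} [Fact p.Prime] (hp4 : p % 4 = 3) {e : AddChar (ZMod p) ℂ}
    (he : e ≠ 1) :
    (#{v : Fin 4 → ZMod p | v 2 * v 3 = v 0 ^ 2 + v 1 ^ 2} : ℝ) = (p : ℝ) ^ 3 - p ^ 2 + p := by
  have h := sum_cone_eq_ite hp4 he 0
  simp only [Pi.zero_apply, zero_mul, sum_const_zero, AddChar.map_zero_eq_one, sum_const,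
    nsmul_eq_mul, mul_one, if_true] at h
  exact_mod_cast h

theorem card_dual_cone {p : ℕ} [Fact p.Prime] (hp4 : p % 4 = 3) :
    #{x : Fin 4 → ZMod p | 4 * (x 2 * x 3) = x 0 ^ 2 + x 1 ^ 2} =
      #{v : Fin 4 → ZMod p | v 2 * v 3 = v 0 ^ 2 + v 1 ^ 2} := by
  have h4 : (4 : ZMod p) ≠ 0 := by
    have h2 : (2 : ZMod p) ≠ 0 := by
      apply Ring.two_ne_zero
      rw [ZMod.ringChar_zmod_n]
      rintro rfl
      omega
    have : (4 : ZMod p) = 2 * 2 := by norm_num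
    simp [this, h2]
  refine card_nbij' (fun x => ![x 0, x 1, 4 * x 2, x 3]) (fun x => ![x 0, x 1, x 2 / 4, x 3])
    ?_ ?_ ?_ ?_
  · intro x hx
    simpa [mul_assoc] using hx
  · intro x hx
    simp only [coe_filter, mem_univ, true_and, Set.mem_ofPred_eq] at hx
    simp [← hx]
    field_simp
  · intro x _
    ext i
    fin_cases i <;> simp [h4]
  · intro x _
    ext i
    fin_cases i <;> simp [h4, mul_div_cancel₀]

theorem sum_comp_ite_dual_cone {p : ℕ} [Fact p.Prime] (hp4 : p % 4 = 3)
    {e : AddChar (ZMod p) ℂ} (he : e ≠ 1) (a b c : ℝ) :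
    ∑ x : Fin 4 → ZMod p,
      (if x = 0 then a else if 4 * (x 2 * x 3) = x 0 ^ 2 + x 1 ^ 2 then b else c) =
    a + ((p : ℝ) ^ 3 - p ^ 2 + p - 1) * b + ((p : ℝ) ^ 4 - (p ^ 3 - p ^ 2 + p)) * c := by
  have h (x : Fin 4 → ZMod p) :
      (if x = 0 then a else if 4 * (x 2 * x 3) = x 0 ^ 2 + x 1 ^ 2 then b else c) =
      (if x = 0 then a - b else 0) +
        (if 4 * (x 2 * x 3) = x 0 ^ 2 + x 1 ^ 2 then b - c else 0) + c := by
    by_cases hx : x = 0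
    · simp [hx]
    · simp only [hx, if_false]
      split_ifs <;> ring
  simp only [h, sum_add_distrib, sum_ite_eq', mem_univ, if_true, ← sum_filter, sum_const,
    card_dual_cone hp4, nsmul_eq_mul, card_cone hp4 he, card_univ, Fintype.card_fun,
    ZMod.card, Fintype.card_fin]
  push_cast
  ring

theorem sum_cone_perturbed {p : ℕ} [Fact p.Prime] (hp4 : p % 4 = 3) {e : AddChar (ZMod p) ℂ}
    (he : e ≠ 1) (ε : ℝ) (x : Fin 4 → ZMod p) :
    ∑ v : Fin 4 → ZMod p with v 2 * v 3 = v 0 ^ 2 + v 1 ^ 2,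
        ((if v = 0 then 1 + ε else 1 : ℝ) : ℂ) * e (∑ i, x i * v i) =
      ((if x = 0 then (p : ℝ) ^ 3 - p ^ 2 + p + ε else
        if 4 * (x 2 * x 3) = x 0 ^ 2 + x 1 ^ 2 then (p : ℝ) - p ^ 2 + ε else p + ε : ℝ) : ℂ) := by
  have h (v : Fin 4 → ZMod p) : ((if v = 0 then 1 + ε else 1 : ℝ) : ℂ) * e (∑ i, x i * v i) =
      e (∑ i, x i * v i) + if v = 0 then (ε : ℂ) else 0 := by
    by_cases hv : v = 0 <;> simp [hv]
  have h0 : (0 : Fin 4 → ZMod p) ∈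
      ({v | v 2 * v 3 = v 0 ^ 2 + v 1 ^ 2} : Finset (Fin 4 → ZMod p)) := by simp
  rw [sum_congr rfl fun v _ => h v, sum_add_distrib, sum_cone_eq_ite hp4 he, sum_ite_eq',
    if_pos h0]
  split_ifs <;> push_cast <;> ring

theorem sum_cone_perturbed_sq {p : ℕ} [Fact p.Prime] (hp4 : p % 4 = 3) {e : AddChar (ZMod p) ℂ}
    (he : e ≠ 1) (ε : ℝ) :
    ∑ v : Fin 4 → ZMod p with v 2 * v 3 = v 0 ^ 2 + v 1 ^ 2, (if v = 0 then 1 + ε else 1) ^ 2 =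
      (p : ℝ) ^ 3 - p ^ 2 + p + 2 * ε + ε ^ 2 := by
  have h (v : Fin 4 → ZMod p) : (if v = 0 then 1 + ε else 1) ^ 2 =
      1 + if v = 0 then 2 * ε + ε ^ 2 else 0 := by
    split_ifs <;> ring
  rw [sum_congr rfl fun v _ => h v, sum_add_distrib, sum_ite_eq', if_pos (by simp), sum_const,
    nsmul_eq_mul, card_cone hp4 he]
  ring

theorem hasDerivAt_quotient_of_quartics (P : ℝ) (hP : P ≠ 0) (hQ : P ^ 2 - P + 1 ≠ 0) :
    HasDerivAt (fun ε : ℝ =>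
      (((P ^ 3 - P ^ 2 + P)⁻¹ * (P ^ 3 - P ^ 2 + P + ε)) ^ 4 +
        (P ^ 3 - P ^ 2 + P - 1) * ((P ^ 3 - P ^ 2 + P)⁻¹ * (P - P ^ 2 + ε)) ^ 4 +
        (P ^ 4 - (P ^ 3 - P ^ 2 + P)) * ((P ^ 3 - P ^ 2 + P)⁻¹ * (P + ε)) ^ 4) /
      ((P ^ 3 - P ^ 2 + P)⁻¹ * (P ^ 3 - P ^ 2 + P + 2 * ε + ε ^ 2)) ^ 2)
      (-(4 * P ^ 2 * (P - 2) * (P - 1) ^ 2 * (P ^ 2 + 1) / (P ^ 2 - P + 1) ^ 5)) 0 := by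
  obtain ⟨M, hM⟩ : ∃ M, M = P ^ 2 - P + 1 := ⟨_, rfl⟩
  have hN : P ^ 3 - P ^ 2 + P = P * M := by rw [hM]; ring
  rw [hN, ← hM]
  rw [← hM] at hQ
  have hpow (k A : ℝ) : HasDerivAt (fun ε : ℝ => (k * (A + ε)) ^ 4) (4 * (k * A) ^ 3 * k) 0 := by
    have := ((((hasDerivAt_id (0 : ℝ)).const_add A).const_mul k).fun_pow 4)
    simpa using this
  have hden (k A : ℝ) : HasDerivAt (fun ε : ℝ => (k * (A + 2 * ε + ε ^ 2)) ^ 2)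
      (4 * (k * A) * k) 0 := by
    have h0 := hasDerivAt_id (0 : ℝ)
    have := ((((h0.const_mul 2).const_add A).add (h0.fun_pow 2)).const_mul k).fun_pow 2
    refine this.congr_deriv ?_
    simp
    ring
  have := (((hpow (P * M)⁻¹ (P * M)).add ((hpow (P * M)⁻¹ (P - P ^ 2)).const_mul (P * M - 1))).add
    ((hpow (P * M)⁻¹ P).const_mul (P ^ 4 - P * M))).div (hden (P * M)⁻¹ (P * M))
    (by simp [hP, hQ])
  refine this.congr_deriv ?_
  simp only [Pi.add_apply, add_zero, mul_zero, ne_eq, OfNat.ofNat_ne_zero, not_false_eq_true,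
    zero_pow]
  field_simp
  rw [hM]
  ring

/-- Constants fail to be critical points for the L²→L⁴ extension inequality on the full
cone Γ₀³ ⊂ 𝔽_p⁴ (p ≡ 3 mod 4): the perturbation functional has strictly negative
derivative at 0. -/
theorem full_cone_Gamma_constants_not_critical
    (p : ℕ) [hp : Fact p.Prime] (hp4 : p % 4 = 3)
    (e : AddChar (ZMod p) ℂ) (he : ∃ x, e x ≠ 1) :
    let C : Finset (Fin 4 → ZMod p) :=
      univ.filter (fun v => v 2 * v 3 = v 0 ^ 2 + v 1 ^ 2)
    let N : ℕ := C.card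
    let fε : ℝ → (Fin 4 → ZMod p) → ℝ :=
      fun ε v => if v ∈ C then (if v = 0 then 1 + ε else 1) else 0
    let Ψ : ℝ → ℝ := fun ε =>
      (∑ x : Fin 4 → ZMod p,
        ‖(N : ℂ)⁻¹ * ∑ v ∈ C, (fε ε v : ℂ) * e (∑ i, x i * v i)‖ ^ 4) /
      ((N : ℝ)⁻¹ * ∑ v ∈ C, fε ε v ^ 2) ^ 2
    HasDerivAt Ψ
      (-(4 * (p : ℝ) ^ 2 * ((p : ℝ) - 2) * ((p : ℝ) - 1) ^ 2 * ((p : ℝ) ^ 2 + 1) /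
        ((p : ℝ) ^ 2 - (p : ℝ) + 1) ^ 5)) 0
    ∧ -(4 * (p : ℝ) ^ 2 * ((p : ℝ) - 2) * ((p : ℝ) - 1) ^ 2 * ((p : ℝ) ^ 2 + 1) /
        ((p : ℝ) ^ 2 - (p : ℝ) + 1) ^ 5) < 0 := by
  intro C N fε Ψ
  have he' : e ≠ 1 := by
    rintro rfl
    simp at he
  have hN : (N : ℝ) = (p : ℝ) ^ 3 - p ^ 2 + p := card_cone hp4 he'
  have hp3 : (3 : ℝ) ≤ p := by
    have : 3 ≤ p := by omega
    exact_mod_cast this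
  have hQ : (0 : ℝ) < (p : ℝ) ^ 2 - p + 1 := by nlinarith
  have hf (ε : ℝ) {v : Fin 4 → ZMod p} (hv : v ∈ C) : fε ε v = if v = 0 then 1 + ε else 1 :=
    if_pos hv
  refine ⟨?_, ?_⟩
  · convert hasDerivAt_quotient_of_quartics (p : ℝ) (by linarith) hQ.ne' using 2 with ε
    have hnorm (x : Fin 4 → ZMod p) :
        ‖(N : ℂ)⁻¹ * ∑ v ∈ C, (fε ε v : ℂ) * e (∑ i, x i * v i)‖ ^ 4 =
        if x = 0 then ((N : ℝ)⁻¹ * ((p : ℝ) ^ 3 - p ^ 2 + p + ε)) ^ 4 else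
          if 4 * (x 2 * x 3) = x 0 ^ 2 + x 1 ^ 2 then ((N : ℝ)⁻¹ * ((p : ℝ) - p ^ 2 + ε)) ^ 4
          else ((N : ℝ)⁻¹ * (p + ε)) ^ 4 := by
      rw [sum_congr rfl fun v hv => by rw [hf ε hv], sum_cone_perturbed hp4 he' ε x,
        ← Complex.ofReal_natCast, ← Complex.ofReal_inv, ← Complex.ofReal_mul, Complex.norm_real,
        Real.norm_eq_abs, (by decide : Even 4).pow_abs]
      split_ifs <;> rfl
    simp only [Ψ]
    rw [sum_congr rfl fun x _ => hnorm x, sum_comp_ite_dual_cone hp4 he',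
      sum_congr rfl fun v hv => by rw [hf ε hv], sum_cone_perturbed_sq hp4 he', hN]
  · rw [neg_lt_zero]
    have h1 : (0 : ℝ) < p - 1 := by linarith
    have h2 : (0 : ℝ) < p - 2 := by linarith
    positivity
end

section
/- Let p be an odd prime and let χ denote the Legendre symbol modulo p (so χ(x) = 1 if x is a nonzero square mod p, −1 if x is a nonsquare, and 0 if x ≡ 0). Define ε_p = 1 if p ≡ 1 (mod 4) and ε_p = i if p ≡ 3 (mod 4). Then for every a ∈ ZMod p, ∑_{x ∈ ZMod p, x ≠ 0} χ(x)·exp(2πi·(a·x).val / p) = χ(a)·ε_p·√p, where (a·x).val ∈ {0,…,p−1} is the canonical representative of a·x ∈ ZMod p. -/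
open Finset

open Complex Filter Topology

/-- Positive real squares come out of the principal square root. -/
theorem ofReal_sq_mul_cpow_half {r : ℝ} (hr : 0 < r) {x : ℂ} (hx : x ≠ 0) :
    ((r : ℂ) ^ 2 * x) ^ (1 / 2 : ℂ) = r * x ^ (1 / 2 : ℂ) := by
  have hr' : (r : ℂ) ≠ 0 := by exact_mod_cast hr.ne'
  rw [cpow_def_of_ne_zero (by positivity), cpow_def_of_ne_zero hx, ← ofReal_pow,
    log_ofReal_mul (by positivity) hx, Real.log_pow, add_mul, Complex.exp_add]
  congr 1
  rw [show (((2 : ℕ) * Real.log r : ℝ) : ℂ) * (1 / 2) = (Real.log r : ℝ) by push_cast; ring,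
    ← ofReal_exp, Real.exp_log hr]

/-- On the real line, the theta function tends to `1` as `im τ → ∞`. -/
theorem tendsto_jacobiTheta₂_ofReal {ι : Type*} {l : Filter ι} {τ : ι → ℂ}
    (hτ : Tendsto (fun i ↦ (τ i).im) l atTop) (x : ℝ) :
    Tendsto (fun i ↦ jacobiTheta₂ x (τ i)) l (𝓝 1) := by
  have h1 : ∑' n : ℤ, (if n = 0 then 1 else 0 : ℂ) = 1 := tsum_ite_eq 0 _
  rw [← h1]
  refine tendsto_tsum_of_dominated_convergence
    (bound := fun n : ℤ ↦ Real.exp (-Real.pi * (1 * n ^ 2 - 2 * 0 * |n|))) ?_ ?_ ?_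
  · simpa using summable_pow_mul_jacobiTheta₂_term_bound 0 one_pos 0
  · intro n
    split_ifs with hn
    · simpa [hn, jacobiTheta₂_term] using tendsto_const_nhds
    · rw [tendsto_zero_iff_norm_tendsto_zero]
      simp_rw [norm_jacobiTheta₂_term]
      refine Real.tendsto_exp_atBot.comp ?_
      have hn' : 0 < Real.pi * (n : ℝ) ^ 2 := by positivity
      simpa using hτ.const_mul_atTop_of_neg (neg_neg_of_pos hn')
  · filter_upwards [hτ.eventually_ge_atTop 1] with i hi n
    exact norm_jacobiTheta₂_term_le one_pos (by simp) hi n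

/-- A theta series with periodic coefficients as a combination of theta functions at `-1 / w`. -/
theorem cpow_half_mul_tsum_periodic {m : ℕ} [NeZero m] {c : ℤ → ℂ}
    (hc : Function.Periodic c m) {w : ℂ} (hw : 0 < w.im) :
    (-I * w) ^ (1 / 2 : ℂ) * ∑' n : ℤ, c n * cexp (Real.pi * I * n ^ 2 * w) =
      (∑ r : Fin m, c r * jacobiTheta₂ ((r / m : ℝ) : ℂ) (-1 / (m ^ 2 * w))) / m := by
  have hm : (0 : ℝ) < m := by exact_mod_cast Nat.pos_of_neZero m
  have hm' : (m : ℂ) ≠ 0 := by exact_mod_cast NeZero.ne m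
  have hw0 : w ≠ 0 := by rintro rfl; simp at hw
  have hIw : -I * w ≠ 0 := by simp [hw0]
  have hmw : 0 < ((m : ℂ) ^ 2 * w).im := by
    rw [← ofReal_natCast, ← ofReal_pow, im_ofReal_mul]; positivity
  have hterm (r : Fin m) : HasSum (fun n : ℤ ↦ c (n * m + (r : ℕ)) *
      cexp (Real.pi * I * ((n * m + (r : ℕ) : ℤ) : ℂ) ^ 2 * w))
      (c (r : ℕ) * (jacobiTheta₂ ((r / m : ℝ) : ℂ) (-1 / (m ^ 2 * w)) /
        (m * (-I * w) ^ (1 / 2 : ℂ)))) := by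
    have h := ((hasSum_jacobiTheta₂_term (m * r * w) hmw).mul_left
      (cexp (Real.pi * I * r ^ 2 * w))).mul_left (c (r : ℕ))
    have hval : cexp (Real.pi * I * r ^ 2 * w) * jacobiTheta₂ (m * r * w) (m ^ 2 * w) =
        jacobiTheta₂ ((r / m : ℝ) : ℂ) (-1 / (m ^ 2 * w)) / (m * (-I * w) ^ (1 / 2 : ℂ)) := by
      have e1 : (m * r * w / (m ^ 2 * w) : ℂ) = ((r / m : ℝ) : ℂ) := by
        push_cast; field_simp
      have e2 : (-Real.pi * I * (m * r * w) ^ 2 / (m ^ 2 * w) : ℂ)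
          = -(Real.pi * I * r ^ 2 * w) := by field_simp
      rw [jacobiTheta₂_functional_equation,
        show -I * ((m : ℂ) ^ 2 * w) = ((m : ℝ) : ℂ) ^ 2 * (-I * w) by push_cast; ring,
        ofReal_sq_mul_cpow_half hm hIw, e1, e2, Complex.exp_neg]
      have := Complex.exp_ne_zero (Real.pi * I * r ^ 2 * w)
      push_cast
      field_simp
    rw [hval] at h
    refine h.congr_fun fun n ↦ ?_
    rw [show c (n * m + (r : ℕ)) = c (r : ℕ) by simpa [add_comm] using hc.int_mul n (r : ℕ),
      jacobiTheta₂_term, ← Complex.exp_add]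
    push_cast
    ring_nf
  have hsq : (-I * w) ^ (1 / 2 : ℂ) ≠ 0 := by simp [cpow_eq_zero_iff, hw0]
  have hsum : HasSum (fun n : ℤ ↦ c n * cexp (Real.pi * I * n ^ 2 * w))
      (∑ r : Fin m, c r * (jacobiTheta₂ ((r / m : ℝ) : ℂ) (-1 / (m ^ 2 * w)) /
        (m * (-I * w) ^ (1 / 2 : ℂ)))) := by
    rw [← (Int.divModEquiv m).symm.hasSum_iff]
    have hfib (r : Fin m) := (Function.Injective.hasSum_iff
      (f := fun x : ℤ × Fin m ↦ if x.2 = r then c (x.1 * m + (x.2 : ℕ)) *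
        cexp (Real.pi * I * ((x.1 * m + (x.2 : ℕ) : ℤ) : ℂ) ^ 2 * w) else 0)
      (Prod.mk_left_injective r) (by
        rintro ⟨n, s⟩ hx
        refine if_neg fun h ↦ hx ⟨n, ?_⟩
        simpa using h.symm)).mp (by simpa [Function.comp_def] using hterm r)
    simpa [Function.comp_def] using hasSum_sum fun r (_ : r ∈ Finset.univ) ↦ hfib r
  rw [hsum.tsum_eq, Finset.mul_sum, Finset.sum_div]
  refine Finset.sum_congr rfl fun r _ ↦ ?_
  field_simp

/-- Asymptotics of a theta series with periodic coefficients as its argument tends to `0`: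
the limit is the mean of the coefficients. -/
theorem tendsto_cpow_half_mul_tsum_periodic {m : ℕ} [NeZero m] {c : ℤ → ℂ}
    (hc : Function.Periodic c m) {ι : Type*} {l : Filter ι} {w : ι → ℂ}
    (hw : Tendsto (fun i ↦ (-1 / w i).im) l atTop) :
    Tendsto (fun i ↦ (-I * w i) ^ (1 / 2 : ℂ) * ∑' n : ℤ, c n * cexp (Real.pi * I * n ^ 2 * w i))
      l (𝓝 ((∑ r : Fin m, c r) / m)) := by
  have hm : (0 : ℝ) < m := by exact_mod_cast Nat.pos_of_neZero m
  have him : Tendsto (fun i ↦ (-1 / ((m : ℂ) ^ 2 * w i)).im) l atTop := by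
    have h : ∀ i, (-1 / ((m : ℂ) ^ 2 * w i)).im = ((m : ℝ) ^ 2)⁻¹ * (-1 / w i).im := fun i ↦ by
      rw [← im_ofReal_mul]
      congr 1
      push_cast
      rw [← div_div, div_right_comm, div_eq_inv_mul]
    simp_rw [h]
    exact hw.const_mul_atTop (by positivity)
  refine Tendsto.congr' (f₁ := fun i ↦ (∑ r : Fin m,
    c r * jacobiTheta₂ ((r / m : ℝ) : ℂ) (-1 / (m ^ 2 * w i))) / m) ?_ ?_
  · filter_upwards [hw.eventually_gt_atTop 0] with i hi
    have := UpperHalfPlane.im_inv_neg_coe_pos ⟨_, hi⟩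
    refine (cpow_half_mul_tsum_periodic hc ?_).symm
    simpa [neg_div] using this
  · refine Tendsto.div_const (tendsto_finsetSum _ fun r _ ↦ ?_) _
    simpa using (tendsto_jacobiTheta₂_ofReal him (r / m)).const_mul (c r)

/-- Evaluation of the quadratic Gauss sum of arbitrary modulus. -/
theorem sum_exp_sq_div (N : ℕ) [NeZero N] :
    ∑ r : Fin N, cexp (2 * Real.pi * I * (r : ℂ) ^ 2 / N) =
      (1 + I) / 2 * (1 + (-I) ^ N) * (√(N : ℝ) : ℂ) := by
  have hN : (0 : ℝ) < N := by exact_mod_cast Nat.pos_of_neZero N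
  have hN' : (N : ℂ) ≠ 0 := by exact_mod_cast NeZero.ne N
  have hs : (√(N : ℝ) : ℂ) ^ 2 = N := by rw [← ofReal_pow, Real.sq_sqrt hN.le]; simp
  have hs0 : (√(N : ℝ) : ℂ) ≠ 0 := by simpa using hN'
  set D : ℝ → ℂ := fun s ↦ N - 2 * I * s ^ 2 with hD
  have hD0 (s : ℝ) : D s ≠ 0 := fun h ↦ by
    have := congrArg re h
    simp [hD, ← ofReal_pow] at this
    exact NeZero.ne N this
  have hDlim : Tendsto D (𝓝[>] 0) (𝓝 N) := by
    have : Continuous D := by fun_prop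
    simpa [hD] using (this.tendsto 0).mono_left nhdsWithin_le_nhds
  have hpos : ∀ᶠ s : ℝ in 𝓝[>] 0, 0 < s := self_mem_nhdsWithin
  -- `2 / D s = 2 / N + w s` and `-1 / (2 / D s) = -N / 2 + v s`
  set w : ℝ → ℂ := fun s ↦ (s : ℂ) ^ 2 * (4 * I / (N * D s)) with hw
  set v : ℝ → ℂ := fun s ↦ (s : ℂ) ^ 2 * I with hv
  have hwinv (s : ℝ) (h : 0 < s) :
      -1 / w s = ((N / 2 : ℝ) : ℂ) + ((N ^ 2 / 4 * (s ^ 2)⁻¹ : ℝ) : ℂ) * I := by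
    have h' : (s : ℂ) ≠ 0 := by exact_mod_cast h.ne'
    have := hD0 s
    simp only [hw]
    push_cast
    field_simp
    simp only [hD]
    linear_combination (-2 * N) * I_sq
  have hsinv : Tendsto (fun s : ℝ ↦ (s ^ 2)⁻¹) (𝓝[>] 0) atTop := by
    refine tendsto_inv_nhdsGT_zero.comp (tendsto_nhdsWithin_iff.mpr ⟨?_, ?_⟩)
    · have : Continuous fun s : ℝ ↦ s ^ 2 := by fun_prop
      simpa using (this.tendsto 0).mono_left nhdsWithin_le_nhds
    · filter_upwards [hpos] with s h using Set.mem_Ioi.mpr (by positivity)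
  have hwlim : Tendsto (fun s ↦ (-1 / w s).im) (𝓝[>] 0) atTop := by
    refine (hsinv.const_mul_atTop (r := (N : ℝ) ^ 2 / 4) (by positivity)).congr' ?_
    filter_upwards [hpos] with s h
    rw [hwinv s h, add_im, ofReal_im, im_ofReal_mul]
    simp
  have hvlim : Tendsto (fun s ↦ (-1 / v s).im) (𝓝[>] 0) atTop := by
    refine hsinv.congr' ?_
    filter_upwards [hpos] with s h
    have : -1 / v s = (((s ^ 2)⁻¹ : ℝ) : ℂ) * I := by
      have h' : (s : ℂ) ≠ 0 := by exact_mod_cast h.ne'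
      simp only [hv]
      push_cast
      field_simp
      simp
    rw [this, im_ofReal_mul]
    simp
  have hc₁ : Function.Periodic (fun n : ℤ ↦ cexp (2 * Real.pi * I * n ^ 2 / N)) N := fun n ↦ by
    refine Complex.exp_eq_exp_iff_exists_int.mpr ⟨2 * n + N, ?_⟩
    push_cast
    field_simp
    ring
  have hc₂ : Function.Periodic (fun n : ℤ ↦ cexp (-Real.pi * I * N * n ^ 2 / 2)) (2 : ℕ) := by
    intro n
    refine Complex.exp_eq_exp_iff_exists_int.mpr ⟨-(N * (n + 1)), ?_⟩
    push_cast
    ring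
  have hF := tendsto_cpow_half_mul_tsum_periodic hc₁ hwlim
  have hH := tendsto_cpow_half_mul_tsum_periodic hc₂ hvlim
  have hA : Tendsto (fun s ↦ (4 / (N * D s)) ^ (1 / 2 : ℂ)) (𝓝[>] 0) (𝓝 (2 / N)) := by
    have h4 : (4 / (N * N) : ℂ) ^ (1 / 2 : ℂ) = 2 / N := by
      rw [show (4 / (N * N) : ℂ) = (2 / N) ^ 2 by ring, one_div, sq_cpow_two_inv]
      rw [← ofReal_natCast, ← ofReal_ofNat, ← ofReal_div, ofReal_re]
      positivity
    rw [← h4]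
    refine Tendsto.cpow (tendsto_const_nhds.div (hDlim.const_mul _) (by simpa using hN'))
      tendsto_const_nhds (Or.inl ?_)
    rw [← ofReal_natCast, ← ofReal_ofNat, ← ofReal_mul, ← ofReal_div, ofReal_re]
    positivity
  have hB : Tendsto (fun s ↦ (-2 * I / D s) ^ (1 / 2 : ℂ)) (𝓝[>] 0)
      (𝓝 ((1 - I) / (√(N : ℝ) : ℂ))) := by
    have h2 : (-2 * I / N : ℂ) ^ (1 / 2 : ℂ) = (1 - I) / (√(N : ℝ) : ℂ) := by
      rw [show (-2 * I / N : ℂ) = ((1 - I) / (√(N : ℝ) : ℂ)) ^ 2 by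
        rw [div_pow, hs]; congr 1; linear_combination -I_sq, one_div, sq_cpow_two_inv]
      rw [div_ofReal_re]
      simpa using hN
    rw [← h2]
    refine Tendsto.cpow (tendsto_const_nhds.div hDlim hN') tendsto_const_nhds (Or.inr ?_)
    simp [NeZero.ne N]
  have hB0 : (1 - I) / (√(N : ℝ) : ℂ) ≠ 0 := by
    refine div_ne_zero (fun h ↦ ?_) hs0
    simpa using congrArg re h
  have hlim := tendsto_nhds_unique (hF.congr' ?_) ((hA.div hB hB0).mul hH)
  · have hsum₂ : ∑ r : Fin 2, cexp (-Real.pi * I * N * ((r : ℕ) : ℤ) ^ 2 / 2) = 1 + (-I) ^ N := by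
      rw [Fin.sum_univ_two, ← exp_neg_pi_div_two_mul_I, ← Complex.exp_nat_mul]
      simp
      ring_nf
    rw [hsum₂] at hlim
    simp only [Int.cast_natCast] at hlim
    rw [div_eq_iff hN'] at hlim
    rw [hlim]
    have h1 : (1 - I : ℂ) ≠ 0 := fun h ↦ hB0 (by simp [h])
    push_cast
    field_simp
    linear_combination (1 + (-I) ^ N) * I_sq
  · filter_upwards [hpos] with s h
    have h' : (s : ℂ) ≠ 0 := by exact_mod_cast h.ne'
    have hDs := hD0 s
    have h₁ : ∑' n : ℤ, cexp (2 * Real.pi * I * n ^ 2 / N) * cexp (Real.pi * I * n ^ 2 * w s) =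
        jacobiTheta₂ 0 (2 / D s) := by
      have : 2 / D s = 2 / N + w s := by
        simp only [hw]
        field_simp
        simp only [hD]
        ring
      refine tsum_congr fun n ↦ ?_
      rw [jacobiTheta₂_term, ← Complex.exp_add, this]
      ring_nf
    have h₂ : ∑' n : ℤ, cexp (-Real.pi * I * N * n ^ 2 / 2) * cexp (Real.pi * I * n ^ 2 * v s) =
        jacobiTheta₂ 0 (-1 / (2 / D s)) := by
      refine tsum_congr fun n ↦ ?_
      rw [jacobiTheta₂_term, ← Complex.exp_add]
      simp only [hv, hD]
      field_simp
      ring_nf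
    rw [h₁, h₂, jacobiTheta₂_functional_equation,
      show -I * w s = (s : ℂ) ^ 2 * (4 / (N * D s)) by
        simp only [hw]; linear_combination (-4 * s ^ 2 / (N * D s)) * I_sq,
      show -I * v s = (s : ℂ) ^ 2 * 1 by simp only [hv]; linear_combination (-s ^ 2) * I_sq,
      ofReal_sq_mul_cpow_half h one_ne_zero, ofReal_sq_mul_cpow_half h (by simp [hN', hDs]),
      show -I * (2 / D s) = -2 * I / D s by ring]
    simp
    ring

/-- The quadratic Gauss sum, expressed through the standard additive character. -/
theorem sum_stdAddChar_sq (N : ℕ) [NeZero N] :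
    ∑ x : ZMod N, ZMod.stdAddChar (x ^ 2) = (1 + I) / 2 * (1 + (-I) ^ N) * (√(N : ℝ) : ℂ) := by
  have hbij : Function.Bijective fun r : Fin N ↦ ((r : ℕ) : ZMod N) := by
    refine (Fintype.bijective_iff_injective_and_card _).mpr ⟨fun r s h ↦ ?_, by simp⟩
    have := congrArg ZMod.val h
    rwa [ZMod.val_cast_of_lt r.2, ZMod.val_cast_of_lt s.2, Fin.val_inj] at this
  rw [← sum_exp_sq_div]
  refine (Fintype.sum_bijective _ hbij _ _ fun r ↦ ?_).symm
  have h := (ZMod.toCircle_natCast (N := N) (r ^ 2)).symm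
  rw [← ZMod.stdAddChar_apply] at h
  simpa only [Nat.cast_pow] using h

/-- Weighted quadratic Gauss sum: for an odd prime p and a ∈ 𝔽_p,
∑_{x ≠ 0} χ(x) e(ax) = χ(a) ε_p √p, where χ is the Legendre symbol and
ε_p = 1 if p ≡ 1 (mod 4), ε_p = i if p ≡ 3 (mod 4). -/
theorem weighted_gauss_sum
    (p : ℕ) [hp : Fact p.Prime] (hp2 : p ≠ 2) (a : ZMod p) :
    ∑ x ∈ univ.filter (fun x : ZMod p => x ≠ 0),
      ((quadraticChar (ZMod p) x : ℤ) : ℂ) *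
        Complex.exp (2 * (Real.pi : ℂ) * Complex.I * ((a * x).val : ℂ) / (p : ℂ))
      = ((quadraticChar (ZMod p) a : ℤ) : ℂ) *
        (if p % 4 = 1 then (1 : ℂ) else Complex.I) * (Real.sqrt p : ℂ) := by
  have hF : ringChar (ZMod p) ≠ 2 := by rwa [ZMod.ringChar_zmod_n]
  have hexp (x : ZMod p) : cexp (2 * Real.pi * I * (x.val : ℂ) / p) = ZMod.stdAddChar x := by
    rw [ZMod.stdAddChar_apply, ZMod.toCircle_apply]
  set χ : MulChar (ZMod p) ℂ := (quadraticChar (ZMod p)).ringHomComp (Int.castRingHom ℂ)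
  have hχ_apply (x : ZMod p) : ((quadraticChar (ZMod p) x : ℤ) : ℂ) = χ x := rfl
  have hχ_inv : χ⁻¹ = χ := ((quadraticChar_isQuadratic (ZMod p)).comp _).inv
  have hχ_ne : χ ≠ 1 :=
    (MulChar.ringHomComp_ne_one_iff Int.cast_injective).mpr (quadraticChar_ne_one hF)
  have hψ : ∑ x : ZMod p, ZMod.stdAddChar x = (0 : ℂ) :=
    AddChar.sum_eq_zero_of_ne_one fun h ↦
      one_ne_zero (ZMod.injective_stdAddChar (by simp [h]) : (1 : ZMod p) = 0)
  have hsq : gaussSum χ ZMod.stdAddChar = ∑ x : ZMod p, ZMod.stdAddChar (x ^ 2) := by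
    rw [← Finset.sum_fiberwise_of_maps_to (g := fun x : ZMod p ↦ x ^ 2) (t := univ) (by simp)]
    have (y : ZMod p) : ∑ x with x ^ 2 = y, ZMod.stdAddChar (x ^ 2) =
        χ y * ZMod.stdAddChar y + ZMod.stdAddChar y := by
      rw [Finset.sum_congr rfl (g := fun _ ↦ ZMod.stdAddChar y) (by simp +contextual), sum_const,
        nsmul_eq_mul, ← add_one_mul, ← hχ_apply]
      congr 1
      have := quadraticChar_card_sqrts hF y
      simp only [Set.toFinset_ofPred] at this
      exact_mod_cast this
    simp_rw [this, sum_add_distrib, hψ, add_zero, gaussSum]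
  have hval : gaussSum χ ZMod.stdAddChar =
      (if p % 4 = 1 then (1 : ℂ) else I) * (Real.sqrt p : ℂ) := by
    rw [hsq, sum_stdAddChar_sq]
    congr 1
    have hpow : (-I) ^ p = (-I) ^ (p % 4) := by
      conv_lhs => rw [← Nat.div_add_mod p 4, pow_add, pow_mul]
      rw [Even.neg_pow (by decide), I_pow_four, one_pow, one_mul]
    rcases Nat.odd_mod_four_iff.mp (hp.out.eq_two_or_odd.resolve_left hp2) with h | h
    · rw [hpow, h, if_pos rfl]
      linear_combination (-1 / 2 : ℂ) * I_sq
    · rw [hpow, h, if_neg (by norm_num)]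
      linear_combination (-I / 2 - I ^ 2 / 2 + 1 / 2 : ℂ) * I_sq
  rw [mul_assoc ((quadraticChar (ZMod p) a : ℤ) : ℂ), ← hval, Finset.sum_filter_of_ne (by
    rintro x - hx rfl
    simp at hx)]
  simp_rw [hexp, hχ_apply]
  have hshift : ∑ x, χ x * ZMod.stdAddChar (a * x) =
      gaussSum χ (AddChar.mulShift ZMod.stdAddChar a) := by
    simp only [gaussSum, AddChar.mulShift_apply]
  rw [hshift]
  rcases eq_or_ne a 0 with rfl | ha
  · rw [AddChar.mulShift_zero, gaussSum_one_right hχ_ne, MulChar.map_zero, zero_mul]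
  · have := gaussSum_mulShift_eq χ ZMod.stdAddChar (Units.mk0 a ha)
    rwa [hχ_inv] at this
end

section
/- Let p be an odd prime, n a positive integer, q = p^n, and let F be a finite field with exactly q elements. For ξ = (ξ₁,ξ₂) ∈ F², write ξ·ξ = ξ₁² + ξ₂². Then for every (ξ,τ) ∈ F²×F, the number of pairs (ξ₁,ξ₂) ∈ F²×F² with ξ₁ + ξ₂ = ξ and ξ₁·ξ₁ + ξ₂·ξ₂ = τ equals: if 2τ = ξ·ξ, then 2q − 1 when q ≡ 1 (mod 4) and 1 when q ≡ 3 (mod 4); if 2τ ≠ ξ·ξ, then q − 1 when q ≡ 1 (mod 4) and q + 1 when q ≡ 3 (mod 4). -/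
open Finset

/-- The correlation of the quadratic character with its reflection about `c / 2`. -/
theorem sum_quadraticChar_mul_quadraticChar_sub {F : Type*} [Field F] [Fintype F] [DecidableEq F]
    (hF : ringChar F ≠ 2) (c : F) :
    ∑ a : F, quadraticChar F a * quadraticChar F (c - a) =
      quadraticChar F (-1) * (if c = 0 then (Fintype.card F : ℤ) - 1 else -1) := by
  split_ifs with hc
  · subst hc
    have h (a : F) : quadraticChar F a * quadraticChar F (0 - a) =
        quadraticChar F (-1) * (1 - if a = 0 then 1 else 0) := by
      split_ifs with ha
      · simp [ha]
      · rw [show (0 : F) - a = -1 * a by ring, map_mul]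
        linear_combination quadraticChar F (-1) * quadraticChar_sq_one ha
    rw [sum_congr rfl fun a _ => h a, ← mul_sum]
    simp [-quadraticChar_apply]
  · have hJ : ∑ a : F, quadraticChar F a * quadraticChar F (1 - a) = -quadraticChar F (-1) := by
      have := jacobiSum_nontrivial_inv (quadraticChar_ne_one hF)
      rwa [(quadraticChar_isQuadratic F).inv] at this
    rw [mul_neg_one, ← hJ, ← Equiv.sum_comp (Equiv.mulLeft₀ c hc)]
    refine sum_congr rfl fun a _ => ?_
    rw [Equiv.mulLeft₀_apply, show c - c * a = c * (1 - a) by ring, map_mul, map_mul]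
    linear_combination quadraticChar F a * quadraticChar F (1 - a) * quadraticChar_sq_one hc

/-- The number of representations of `c` as a sum of two squares in a finite field of odd
characteristic. -/
theorem card_sq_add_sq_eq {F : Type*} [Field F] [Fintype F] [DecidableEq F]
    (hF : ringChar F ≠ 2) (c : F) :
    ((univ.filter fun x : F × F => x.1 ^ 2 + x.2 ^ 2 = c).card : ℤ) =
      Fintype.card F +
        quadraticChar F (-1) * (if c = 0 then (Fintype.card F : ℤ) - 1 else -1) := by
  have hsqrt (a : F) :
      ((univ.filter fun x : F => x ^ 2 = a).card : ℤ) = quadraticChar F a + 1 := by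
    rw [← quadraticChar_card_sqrts hF]
    congr 2
    ext; simp
  have hfiber (a : F) :
      ((univ.filter fun x : F × F => x.1 ^ 2 + x.2 ^ 2 = c).filter fun x => x.1 ^ 2 = a) =
        (univ.filter fun x : F => x ^ 2 = a) ×ˢ (univ.filter fun x : F => x ^ 2 = c - a) := by
    ext x
    simp only [mem_filter, mem_univ, true_and, mem_product]
    grind
  have hreflect : ∑ a : F, quadraticChar F (c - a) = 0 :=
    ((Equiv.subLeft c).sum_comp (quadraticChar F)).trans (quadraticChar_sum_zero hF)
  rw [card_eq_sum_card_fiberwise (f := fun x : F × F => x.1 ^ 2) (t := univ) (by simp)]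
  simp only [hfiber, card_product, Nat.cast_sum, Nat.cast_mul, hsqrt, add_mul, mul_add,
    sum_add_distrib, sum_quadraticChar_mul_quadraticChar_sub hF, one_mul, mul_one,
    quadraticChar_sum_zero hF, hreflect]
  simp [add_comm]

/-- Pairs with prescribed sum and prescribed sum of square lengths are parametrized by their
difference. -/
theorem card_pairs_add_eq_sq_add_sq {F : Type*} [Field F] [Fintype F] [DecidableEq F]
    (h2 : (2 : F) ≠ 0) (ξ : F × F) (τ : F) :
    (univ.filter (fun y : (F × F) × (F × F) =>
        y.1 + y.2 = ξ ∧
        (y.1.1 ^ 2 + y.1.2 ^ 2) + (y.2.1 ^ 2 + y.2.2 ^ 2) = τ)).card =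
      (univ.filter fun x : F × F => x.1 ^ 2 + x.2 ^ 2 = 2 * τ - (ξ.1 ^ 2 + ξ.2 ^ 2)).card := by
  refine card_nbij' (fun y => y.1 - y.2)
    (fun d => (((ξ.1 + d.1) / 2, (ξ.2 + d.2) / 2), ((ξ.1 - d.1) / 2, (ξ.2 - d.2) / 2)))
    ?_ ?_ ?_ ?_
  · rintro ⟨⟨a, b⟩, c, d⟩ h
    simp only [coe_filter, mem_univ, true_and, Set.mem_ofPred_eq] at h ⊢
    obtain ⟨rfl, rfl⟩ := h
    simp only [Prod.mk_sub_mk, Prod.mk_add_mk]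
    ring
  · rintro ⟨a, b⟩ h
    simp only [coe_filter, mem_univ, true_and, Set.mem_ofPred_eq] at h ⊢
    refine ⟨?_, ?_⟩
    · ext <;> simp only [Prod.mk_add_mk] <;> field_simp <;> ring
    · field_simp
      linear_combination 2 * h
  · rintro ⟨⟨a, b⟩, c, d⟩ h
    simp only [coe_filter, mem_univ, true_and, Set.mem_ofPred_eq] at h
    obtain ⟨rfl, rfl⟩ := h
    ext <;> simp only [Prod.mk_sub_mk, Prod.mk_add_mk] <;> field_simp <;> ring
  · rintro ⟨a, b⟩ _
    ext <;> simp only [Prod.mk_sub_mk] <;> field_simp <;> ring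

/-- Two-fold convolution count on the paraboloid P² ⊂ F³: the number of pairs of points
of P² whose frequency components sum to (ξ, τ). -/
theorem paraboloid_two_fold_convolution_count
    (p n q : ℕ) (hp : p.Prime) (hp2 : p ≠ 2) (hn : 0 < n) (hq : q = p ^ n)
    (F : Type) [Field F] [Fintype F] [DecidableEq F] (hF : Fintype.card F = q)
    (ξ : F × F) (τ : F) :
    let Npairs : ℕ :=
      (univ.filter (fun y : (F × F) × (F × F) =>
        y.1 + y.2 = ξ ∧
        (y.1.1 ^ 2 + y.1.2 ^ 2) + (y.2.1 ^ 2 + y.2.2 ^ 2) = τ)).card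
    (2 * τ = ξ.1 ^ 2 + ξ.2 ^ 2 →
      (q % 4 = 1 → Npairs = 2 * q - 1) ∧ (q % 4 = 3 → Npairs = 1))
    ∧ (2 * τ ≠ ξ.1 ^ 2 + ξ.2 ^ 2 →
      (q % 4 = 1 → Npairs = q - 1) ∧ (q % 4 = 3 → Npairs = q + 1)) := by
  intro Npairs
  have hchar : ringChar F ≠ 2 := by
    intro h
    have := FiniteField.even_card_of_char_two h
    rw [hF, hq] at this
    have hodd : Odd (p ^ n) := (hp.odd_of_ne_two hp2).pow
    rw [Nat.odd_iff] at hodd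
    omega
  have hN := card_sq_add_sq_eq hchar (2 * τ - (ξ.1 ^ 2 + ξ.2 ^ 2))
  rw [← card_pairs_add_eq_sq_add_sq (Ring.two_ne_zero hchar), quadraticChar_neg_one hchar, hF] at hN
  change (Npairs : ℤ) = _ at hN
  refine ⟨fun h => ⟨fun hq1 => ?_, fun hq3 => ?_⟩, fun h => ⟨fun hq1 => ?_, fun hq3 => ?_⟩⟩
  · rw [if_pos (sub_eq_zero.mpr h), ZMod.χ₄_nat_one_mod_four hq1] at hN
    omega
  · rw [if_pos (sub_eq_zero.mpr h), ZMod.χ₄_nat_three_mod_four hq3] at hN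
    omega
  · rw [if_neg (sub_ne_zero.mpr h), ZMod.χ₄_nat_one_mod_four hq1] at hN
    omega
  · rw [if_neg (sub_ne_zero.mpr h), ZMod.χ₄_nat_three_mod_four hq3] at hN
    omega
end

section
/- Let p be a prime with p > 3, n a positive integer, q = p^n, and let F be a finite field with exactly q elements. Then for every (ξ,τ) ∈ F×F, the number of triples (ξ₁,ξ₂,ξ₃) ∈ F³ with ξ₁ + ξ₂ + ξ₃ = ξ and ξ₁² + ξ₂² + ξ₃² = τ equals: if 3τ = ξ², then 2q − 1 when q ≡ 1 (mod 3) and 1 when q ≡ 2 (mod 3); if 3τ ≠ ξ², then q − 1 when q ≡ 1 (mod 3) and q + 1 when q ≡ 2 (mod 3). -/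
open Finset

section EisensteinForm

variable {F : Type*} [Field F] [Fintype F]

theorem exists_primitive_cube_root (h : Fintype.card F % 3 = 1) :
    ∃ w : F, w ^ 2 + w + 1 = 0 := by
  classical
  have : Fact (Nat.Prime 3) := ⟨Nat.prime_three⟩
  obtain ⟨u, hu⟩ := exists_prime_orderOf_dvd_card (G := Fˣ) 3 (by
    rw [Fintype.card_units]; omega)
  have hu3 : (u : F) ^ 3 = 1 := by
    rw [← Units.val_pow_eq_pow_val, ← hu, pow_orderOf_eq_one, Units.val_one]
  have hu1 : (u : F) - 1 ≠ 0 := by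
    intro h1
    have : u = 1 := Units.ext (by simpa using sub_eq_zero.mp h1)
    simp [this] at hu
  refine ⟨u, mul_left_cancel₀ hu1 ?_⟩
  linear_combination hu3

theorem card_mod_three_ne_two_of_cube_root (h3 : (3 : F) ≠ 0) {w : F}
    (hw : w ^ 2 + w + 1 = 0) : Fintype.card F % 3 ≠ 2 := by
  classical
  have hw3 : w ^ 3 = 1 := by linear_combination (w - 1) * hw
  have hw1 : w ≠ 1 := by
    rintro rfl
    exact h3 (by linear_combination hw)
  have hord : orderOf w = 3 :=
    have : Fact (Nat.Prime 3) := ⟨Nat.prime_three⟩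
    orderOf_eq_prime hw3 hw1
  have hw0 : w ≠ 0 := by
    rintro rfl
    simp at hw
  have hdvd : 3 ∣ Fintype.card F - 1 := by
    rw [← hord]
    exact orderOf_dvd_of_pow_eq_one (FiniteField.pow_card_sub_one_eq_one w hw0)
  omega

theorem eisenstein_surjective (h2 : (2 : F) ≠ 0) (h3 : (3 : F) ≠ 0) (c : F) :
    ∃ s t : F, s ^ 2 + s * t + t ^ 2 = c := by
  classical
  have hodd : Fintype.card F % 2 = 1 :=
    FiniteField.odd_card_of_char_ne_two fun hc => h2 (by
      have := CharP.cast_eq_zero F (ringChar F)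
      rw [hc] at this
      exact_mod_cast this)
  obtain ⟨a, b, hab⟩ := FiniteField.exists_root_sum_quadratic (R := F)
    (f := Polynomial.C 1 * Polynomial.X ^ 2 + Polynomial.C 0 * Polynomial.X + Polynomial.C 0)
    (g := Polynomial.C 3 * Polynomial.X ^ 2 + Polynomial.C 0 * Polynomial.X
      + Polynomial.C (-(4 * c)))
    (Polynomial.degree_quadratic one_ne_zero) (Polynomial.degree_quadratic h3) hodd
  simp only [Polynomial.eval_add, Polynomial.eval_mul, Polynomial.eval_C, Polynomial.eval_pow,
    Polynomial.eval_X] at hab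
  refine ⟨(a - b) / 2, b, ?_⟩
  field_simp
  linear_combination hab

variable [DecidableEq F]

/-- The number of representations of `c` by the binary form `a² + ab + b²` over `F`. -/
def eisensteinCount (F : Type*) [Field F] [Fintype F] [DecidableEq F] (c : F) : ℕ :=
  (univ.filter (fun z : F × F => z.1 ^ 2 + z.1 * z.2 + z.2 ^ 2 = c)).card

/-- The number of points of the hyperbola `uv = c`. -/
theorem card_filter_mul_eq (c : F) :
    (univ.filter (fun z : F × F => z.1 * z.2 = c)).card =
      if c = 0 then 2 * Fintype.card F - 1 else Fintype.card F - 1 := by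
  split_ifs with hc
  · subst hc
    have h : univ.filter (fun z : F × F => z.1 * z.2 = 0) =
        ((univ : Finset F).image fun x => (x, (0 : F))) ∪
          ((univ.erase (0 : F)).image fun y => ((0 : F), y)) := by
      ext ⟨x, y⟩
      simp only [mem_filter, mem_univ, true_and, mul_eq_zero, mem_union, mem_image, mem_erase,
        Prod.mk.injEq]
      constructor
      · rintro (rfl | rfl)
        · by_cases hy : y = 0
          · exact Or.inl ⟨0, rfl, hy.symm⟩
          · exact Or.inr ⟨y, ⟨hy, trivial⟩, rfl, rfl⟩
        · exact Or.inl ⟨x, rfl, rfl⟩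
      · rintro (⟨-, -, h⟩ | ⟨-, -, h, -⟩)
        · exact Or.inr h.symm
        · exact Or.inl h.symm
    rw [h, card_union_of_disjoint, card_image_of_injective, card_image_of_injective,
      card_erase_of_mem (mem_univ _), card_univ]
    · have := Fintype.card_pos (α := F)
      omega
    · intro x y hxy
      simpa using hxy
    · intro x y hxy
      simpa using hxy
    · rw [disjoint_left]
      rintro ⟨x, y⟩ h1 h2
      simp only [mem_image, mem_univ, true_and, mem_erase, Prod.mk.injEq] at h1 h2
      grind
  · have h : univ.filter (fun z : F × F => z.1 * z.2 = c) =
        (univ.erase (0 : F)).image fun x => (x, c / x) := by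
      ext ⟨x, y⟩
      simp only [mem_filter, mem_univ, true_and, mem_image, mem_erase, Prod.mk.injEq]
      constructor
      · rintro rfl
        have hx : x ≠ 0 := left_ne_zero_of_mul hc
        exact ⟨x, ⟨hx, trivial⟩, rfl, mul_div_cancel_left₀ y hx⟩
      · rintro ⟨x, ⟨hx, -⟩, rfl, rfl⟩
        exact mul_div_cancel₀ c hx
    rw [h, card_image_of_injective, card_erase_of_mem (mem_univ _), card_univ]
    intro x y hxy
    exact (Prod.mk.inj hxy).1

theorem eisensteinCount_of_card_mod_three_eq_one (h3 : (3 : F) ≠ 0)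
    (h : Fintype.card F % 3 = 1) (c : F) :
    eisensteinCount F c =
      if c = 0 then 2 * Fintype.card F - 1 else Fintype.card F - 1 := by
  obtain ⟨w, hw⟩ := exists_primitive_cube_root h
  rw [← card_filter_mul_eq, eisensteinCount]
  obtain ⟨d, hdw⟩ : ∃ d, d = 2 * w + 1 := ⟨_, rfl⟩
  have hd : d ≠ 0 := by
    intro h0
    exact h3 (by linear_combination 4 * hw - (2 * w + 1) * (h0 - hdw))
  refine card_bij' (fun z _ => (z.1 - w * z.2, z.1 + (w + 1) * z.2))
    (fun z _ => (((w + 1) * z.1 + w * z.2) / d, (z.2 - z.1) / d)) ?_ ?_ ?_ ?_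
  · rintro ⟨a, b⟩ hz
    simp only [mem_filter, mem_univ, true_and] at hz ⊢
    linear_combination hz - b ^ 2 * hw
  · rintro ⟨u, v⟩ hz
    simp only [mem_filter, mem_univ, true_and] at hz ⊢
    field_simp
    subst hdw
    linear_combination (2 * w + 1) ^ 2 * hz + (u ^ 2 + v ^ 2 - 2 * u * v) * hw
  · rintro ⟨a, b⟩ -
    ext <;> field_simp <;> rw [hdw] <;> ring
  · rintro ⟨u, v⟩ -
    ext <;> field_simp <;> rw [hdw] <;> ring

theorem eisensteinCount_eq_eisensteinCount_one (h2 : (2 : F) ≠ 0) (h3 : (3 : F) ≠ 0) {c : F}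
    (hc : c ≠ 0) : eisensteinCount F c = eisensteinCount F 1 := by
  obtain ⟨s, t, hst⟩ := eisenstein_surjective h2 h3 c
  symm
  refine card_bij' (fun z _ => (z.1 * s - z.2 * t, z.1 * t + z.2 * s + z.2 * t))
    (fun z _ => ((z.1 * (s + t) + z.2 * t) / c, (z.2 * s - z.1 * t) / c)) ?_ ?_ ?_ ?_
  · rintro ⟨a, b⟩ hz
    simp only [mem_filter, mem_univ, true_and] at hz ⊢
    linear_combination c * hz + (a ^ 2 + a * b + b ^ 2) * hst
  · rintro ⟨a, b⟩ hz
    simp only [mem_filter, mem_univ, true_and] at hz ⊢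
    field_simp
    linear_combination c * hz + (a ^ 2 + a * b + b ^ 2) * hst
  · rintro ⟨a, b⟩ -
    ext <;> field_simp
    · linear_combination a * hst
    · linear_combination b * hst
  · rintro ⟨a, b⟩ -
    ext <;> field_simp
    · linear_combination a * hst
    · linear_combination b * hst

theorem eisensteinCount_zero_of_card_mod_three_eq_two (h3 : (3 : F) ≠ 0)
    (h : Fintype.card F % 3 = 2) : eisensteinCount F 0 = 1 := by
  rw [eisensteinCount, card_eq_one]
  refine ⟨(0, 0), ?_⟩
  ext ⟨a, b⟩
  simp only [mem_filter, mem_univ, true_and, mem_singleton, Prod.mk.injEq]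
  constructor
  · intro hab
    have hb : b = 0 := by
      by_contra hb
      refine card_mod_three_ne_two_of_cube_root h3 (w := a / b) ?_ h
      field_simp
      linear_combination hab
    subst hb
    simpa using hab
  · rintro ⟨rfl, rfl⟩
    ring

theorem sum_eisensteinCount : ∑ c : F, eisensteinCount F c = Fintype.card F ^ 2 := by
  have h := card_eq_sum_card_fiberwise (s := (univ : Finset (F × F))) (t := (univ : Finset F))
    (f := fun z => z.1 ^ 2 + z.1 * z.2 + z.2 ^ 2) (fun _ _ => by simp)
  rw [card_univ, Fintype.card_prod] at h
  rw [sq, h]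
  rfl

theorem eisensteinCount_of_card_mod_three_eq_two (h2 : (2 : F) ≠ 0) (h3 : (3 : F) ≠ 0)
    (h : Fintype.card F % 3 = 2) {c : F} (hc : c ≠ 0) :
    eisensteinCount F c = Fintype.card F + 1 := by
  have hsum := sum_eisensteinCount (F := F)
  rw [← add_sum_erase _ _ (mem_univ (0 : F)),
    eisensteinCount_zero_of_card_mod_three_eq_two h3 h,
    sum_congr rfl fun d hd => eisensteinCount_eq_eisensteinCount_one h2 h3 (ne_of_mem_erase hd),
    sum_const, card_erase_of_mem (mem_univ _), card_univ, smul_eq_mul] at hsum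
  rw [eisensteinCount_eq_eisensteinCount_one h2 h3 hc]
  obtain ⟨m, hm⟩ : ∃ m, Fintype.card F = m + 2 := ⟨Fintype.card F - 2, by omega⟩
  rw [hm] at hsum ⊢
  have hpos : 0 < m + 1 := m.succ_pos
  refine Nat.eq_of_mul_eq_mul_left hpos ?_
  rw [show m + 2 - 1 = m + 1 by omega] at hsum
  linarith

theorem card_parabola_triples_eq_eisensteinCount (h2 : (2 : F) ≠ 0) (h3 : (3 : F) ≠ 0)
    (ξ τ : F) :
    (univ.filter (fun y : F × F × F =>
        y.1 + y.2.1 + y.2.2 = ξ ∧ y.1 ^ 2 + y.2.1 ^ 2 + y.2.2 ^ 2 = τ)).card =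
      eisensteinCount F ((3 * τ - ξ ^ 2) / (2 * 3)) := by
  refine card_bij' (fun y _ => (y.1 - ξ / 3, y.2.1 - ξ / 3))
    (fun z _ => (z.1 + ξ / 3, z.2 + ξ / 3, ξ / 3 - z.1 - z.2)) ?_ ?_ ?_ ?_
  · rintro ⟨a, b, d⟩ hy
    simp only [mem_filter, mem_univ, true_and] at hy ⊢
    obtain ⟨rfl, rfl⟩ := hy
    field_simp
    ring
  · rintro ⟨a, b⟩ hz
    simp only [mem_filter, mem_univ, true_and] at hz ⊢
    rw [eq_div_iff (mul_ne_zero h2 h3)] at hz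
    refine ⟨by field_simp; ring, ?_⟩
    field_simp
    linear_combination 3 * hz
  · rintro ⟨a, b, d⟩ hy
    simp only [mem_filter, mem_univ, true_and] at hy
    obtain ⟨rfl, -⟩ := hy
    ext <;> field_simp <;> ring
  · rintro ⟨a, b⟩ -
    ext <;> simp

end EisensteinForm

/-- Three-fold convolution count on the parabola P¹ ⊂ F²: the number of triples of points
of P¹ whose frequency components sum to (ξ, τ). -/
theorem parabola_three_fold_convolution_count
    (p n q : ℕ) (hp : p.Prime) (hp3 : 3 < p) (hn : 0 < n) (hq : q = p ^ n)
    (F : Type) [Field F] [Fintype F] [DecidableEq F] (hF : Fintype.card F = q)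
    (ξ τ : F) :
    let Ntriples : ℕ :=
      (univ.filter (fun y : F × F × F =>
        y.1 + y.2.1 + y.2.2 = ξ ∧
        y.1 ^ 2 + y.2.1 ^ 2 + y.2.2 ^ 2 = τ)).card
    (3 * τ = ξ ^ 2 →
      (q % 3 = 1 → Ntriples = 2 * q - 1) ∧ (q % 3 = 2 → Ntriples = 1))
    ∧ (3 * τ ≠ ξ ^ 2 →
      (q % 3 = 1 → Ntriples = q - 1) ∧ (q % 3 = 2 → Ntriples = q + 1)) := by
  intro Ntriples
  have hqF : (q : F) = 0 := by rw [← hF]; exact Nat.cast_card_eq_zero F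
  have hpF : (p : F) = 0 := by
    rw [hq, Nat.cast_pow] at hqF
    exact eq_zero_of_pow_eq_zero hqF
  have natCast_ne_zero : ∀ r : ℕ, r.Prime → r < p → (r : F) ≠ 0 := by
    intro r hr hrp hr0
    have hco : IsCoprime (r : ℤ) (p : ℤ) :=
      Nat.isCoprime_iff_coprime.mpr ((Nat.coprime_primes hr hp).mpr hrp.ne)
    obtain ⟨a, b, hab⟩ := hco
    have := congrArg (Int.cast : ℤ → F) hab
    push_cast at this
    simp [hr0, hpF] at this
  have h2 : (2 : F) ≠ 0 := by exact_mod_cast natCast_ne_zero 2 Nat.prime_two (by omega)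
  have h3 : (3 : F) ≠ 0 := by exact_mod_cast natCast_ne_zero 3 Nat.prime_three hp3
  have hN : Ntriples = eisensteinCount F ((3 * τ - ξ ^ 2) / (2 * 3)) :=
    card_parabola_triples_eq_eisensteinCount h2 h3 ξ τ
  rw [hN, ← hF]
  refine ⟨fun h => ?_, fun h => ?_⟩
  · rw [h, sub_self, zero_div]
    refine ⟨fun h1 => ?_, eisensteinCount_zero_of_card_mod_three_eq_two h3⟩
    rw [eisensteinCount_of_card_mod_three_eq_one h3 h1, if_pos rfl]
  · have hc := div_ne_zero (sub_ne_zero.mpr h) (mul_ne_zero h2 h3)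
    refine ⟨fun h1 => ?_, fun h1 => eisensteinCount_of_card_mod_three_eq_two h2 h3 h1 hc⟩
    rw [eisensteinCount_of_card_mod_three_eq_one h3 h1, if_neg hc]
end

section
/- Let p be an odd prime, n a positive integer, q = p^n, and let F be a finite field with exactly q elements, with field trace Tr : F → ZMod p. Suppose ρ : F → ℂ satisfies |ρ(x)| = 1 for all x ∈ F, ρ(0) = 1, and ρ(x)·ρ(y) = ρ((x+y)/2)² for all x, y ∈ F (division by 2 is meaningful since p is odd). Then there exists a unique a ∈ F such that for all x ∈ F, ρ(x) = exp(2πi·t/p), where t ∈ {0,…,p−1} is the canonical representative of Tr(a·x) ∈ ZMod p. -/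
/-- Over a finite commutative ring, every complex additive character is a multiplicative shift of
any given primitive one. -/
theorem AddChar.IsPrimitive.mulShift_bijective {R : Type*} [CommRing R] [Finite R]
    {ψ : AddChar R ℂ} (hψ : ψ.IsPrimitive) : Function.Bijective (AddChar.mulShift ψ) := by
  have := Fintype.ofFinite R
  exact (Fintype.bijective_iff_injective_and_card _).2
    ⟨AddChar.to_mulShift_inj_of_isPrimitive hψ, AddChar.card_eq.symm⟩

/-- The standard additive character of `ZMod p` composed with the trace is primitive. -/
theorem FiniteField.isPrimitive_stdAddChar_comp_trace (p : ℕ) [Fact p.Prime] (F : Type*) [Field F]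
    [Finite F] [Algebra (ZMod p) F] :
    ((ZMod.stdAddChar (N := p)).compAddMonoidHom
      (Algebra.trace (ZMod p) F).toAddMonoidHom).IsPrimitive := by
  refine AddChar.IsPrimitive.of_ne_one (AddChar.ne_one_iff.2 ?_)
  obtain ⟨x, hx⟩ := Algebra.trace_surjective (ZMod p) F 1
  refine ⟨x, fun h => one_ne_zero (α := ZMod p) (ZMod.injective_stdAddChar ?_)⟩
  simpa [hx] using h

/-- The additive character underlying a solution of the midpoint equation. -/
def AddChar.ofMidpoint {K M : Type*} [Field K] [Monoid M] (f : K → M) (h0 : f 0 = 1)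
    (h : ∀ x y : K, f x * f y = f ((x + y) / 2) ^ 2) : AddChar K M where
  toFun := f
  map_zero_eq_one' := h0
  map_add_eq_mul' x y := by
    rw [h x y, ← add_zero (x + y), ← h (x + y) 0, add_zero, h0, mul_one]

/-- A unimodular function ρ on a finite field F of cardinality q = pⁿ (p odd prime)
satisfying ρ(0) = 1 and ρ(x)ρ(y) = ρ((x+y)/2)² is an additive character:
ρ(x) = exp(2πi Tr(ax)/p) for a unique a ∈ F. -/
theorem midpoint_functional_equation_characters
    (p n q : ℕ) (hp : p.Prime) (hp2 : p ≠ 2) (hn : 0 < n) (hq : q = p ^ n)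
    (F : Type) [Field F] [Fintype F] [Algebra (ZMod p) F] (hF : Fintype.card F = q)
    (ρ : F → ℂ) (hρ1 : ∀ x, ‖ρ x‖ = 1) (hρ0 : ρ 0 = 1)
    (hρ : ∀ x y : F, ρ x * ρ y = ρ ((x + y) / 2) ^ 2) :
    ∃! a : F, ∀ x : F,
      ρ x = Complex.exp (2 * (Real.pi : ℂ) * Complex.I *
        ((Algebra.trace (ZMod p) F (a * x)).val : ℂ) / (p : ℂ)) := by
  have : Fact p.Prime := ⟨hp⟩
  have hexp (t : ZMod p) :
      Complex.exp (2 * (Real.pi : ℂ) * Complex.I * (t.val : ℂ) / (p : ℂ)) =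
        ZMod.stdAddChar t := by
    simpa using (ZMod.stdAddChar_coe (N := p) (t.val : ℤ)).symm
  simp only [hexp]
  refine (existsUnique_congr fun a => ?_).mp
    ((FiniteField.isPrimitive_stdAddChar_comp_trace p F).mulShift_bijective.existsUnique
      (AddChar.ofMidpoint ρ hρ0 hρ))
  rw [eq_comm, DFunLike.ext_iff]
  rfl
end
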